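/- arXiv:1411.5619 — 2 statements merged into one kernel-verified Lean document; each statement's English description precedes it below -/
import Mathlib

section
/- Let A be a separable C*-algebra. Every element x ∈ Cu(A) can be written as the Cuntz class of the strict limit of an increasing sequence of projections in the multiplier algebra M(A⊗K). -/
open Filter Topology

namespace CuntzOP

variable {H : Type*} [NormedAddCommGroup H] [InnerProductSpace ℂ H] [CompleteSpace H]

/-- The Loewner order on bounded operators on a Hilbert space. -/
def opLE (a b : H →L[ℂ] H) : Prop := (b - a).IsPositive

/-- `A` is a (not necessarily unital) norm-closed *-subalgebra of `B(H)`,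
i.e. a concrete C*-algebra. -/
def IsCStarSubalg (A : Set (H →L[ℂ] H)) : Prop :=
  (0 : H →L[ℂ] H) ∈ A ∧ (∀ x ∈ A, ∀ y ∈ A, x + y ∈ A) ∧
    (∀ (c : ℂ), ∀ x ∈ A, c • x ∈ A) ∧ (∀ x ∈ A, ∀ y ∈ A, x * y ∈ A) ∧
    (∀ x ∈ A, star x ∈ A) ∧ IsClosed A

/-- `A` acts nondegenerately on `H` (as in the universal representation). -/
def Nondegenerate (A : Set (H →L[ℂ] H)) : Prop :=
  ∀ x : H, ∀ ε : ℝ, 0 < ε → ∃ a ∈ A, ‖a x - x‖ < ε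

/-- The closure of a set of operators in the strong operator topology.  For a
C*-algebra `A` in its universal representation, `sotClosure A` is identified with
the bidual `A**`. -/
def sotClosure (S : Set (H →L[ℂ] H)) : Set (H →L[ℂ] H) :=
  {T | ∀ ε : ℝ, 0 < ε → ∀ v : Finset H, ∃ s ∈ S, ∀ x ∈ v, ‖T x - s x‖ < ε}

/-- An orthogonal projection (self-adjoint idempotent). -/
def IsProjectionOp (p : H →L[ℂ] H) : Prop := IsSelfAdjoint p ∧ IsIdempotentElem p

/-- Convergence of a sequence of operators in the strong operator topology. -/
def SOTTendsto (T : ℕ → H →L[ℂ] H) (S : H →L[ℂ] H) : Prop :=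
  ∀ x : H, Tendsto (fun n => T n x) atTop (𝓝 (S x))

/-- A projection `p ∈ A**` is open if it is the strong limit of an increasing net of
positive elements of `A`. -/
def IsOpenProjection (A : Set (H →L[ℂ] H)) (p : H →L[ℂ] H) : Prop :=
  IsProjectionOp p ∧
    ∃ (ι : Type) (le : ι → ι → Prop) (a : ι → H →L[ℂ] H),
      Nonempty ι ∧ (∀ i, le i i) ∧ (∀ i j k, le i j → le j k → le i k) ∧
      (∀ i j, ∃ k, le i k ∧ le j k) ∧
      (∀ i, a i ∈ A) ∧ (∀ i, (a i).IsPositive) ∧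
      (∀ i j, le i j → opLE (a i) (a j)) ∧
      ∀ x : H, ∀ ε : ℝ, 0 < ε → ∃ i, ∀ j, le i j → ‖a j x - p x‖ < ε

/-- The hereditary subalgebra `A_p = pA**p ∩ A = pAp ∩ A` associated to a projection
`p ∈ A**`. -/
def her (A : Set (H →L[ℂ] H)) (p : H →L[ℂ] H) : Set (H →L[ℂ] H) :=
  {a | a ∈ A ∧ p * a * p = a}

/-- A projection is closed if its complement is open. -/
def IsClosedProjection (A : Set (H →L[ℂ] H)) (p : H →L[ℂ] H) : Prop :=
  IsProjectionOp p ∧ IsOpenProjection A (1 - p)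

/-- `c` is the closure `p̄` of the open projection `p`: the least closed projection
dominating `p`. -/
def IsClosureOf (A : Set (H →L[ℂ] H)) (p c : H →L[ℂ] H) : Prop :=
  IsClosedProjection A c ∧ opLE p c ∧
    ∀ q, IsClosedProjection A q → opLE p q → opLE c q

/-- Compact containment `p ⊂⊂ q` of open projections: the closure of `p` is compact in
`A_q`, i.e. `p̄ a = p̄` for some positive contraction `a ∈ A_q`. -/
def IsCompactlyContained (A : Set (H →L[ℂ] H)) (p q : H →L[ℂ] H) : Prop :=
  ∃ c, IsClosureOf A p c ∧ ∃ a ∈ her A q, a.IsPositive ∧ ‖a‖ ≤ 1 ∧ c * a = c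

/-- Peligrad–Zsidó equivalence of open projections. -/
def PZEquiv (A : Set (H →L[ℂ] H)) (p q : H →L[ℂ] H) : Prop :=
  ∃ v ∈ sotClosure A, star v * v = p ∧ v * star v = q ∧
    (∀ a ∈ her A p, v * a ∈ A) ∧ ∀ a ∈ her A q, star v * a ∈ A

/-- Cuntz subequivalence of open projections: `p ≾ q` iff every `p' ⊂⊂ p` is
PZ-equivalent to some `q' ⊂⊂ q`. -/
def CuLE (A : Set (H →L[ℂ] H)) (p q : H →L[ℂ] H) : Prop :=
  ∀ p', IsOpenProjection A p' → IsCompactlyContained A p' p →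
    ∃ q', IsOpenProjection A q' ∧ IsCompactlyContained A q' q ∧ PZEquiv A p' q'

/-- Cuntz equivalence of open projections. -/
def CuEquiv (A : Set (H →L[ℂ] H)) (p q : H →L[ℂ] H) : Prop :=
  CuLE A p q ∧ CuLE A q p

/-- Compact subequivalence `p ≺≺ q`: `p` is PZ-equivalent to some `q' ⊂⊂ q`. -/
def CompactSubequiv (A : Set (H →L[ℂ] H)) (p q : H →L[ℂ] H) : Prop :=
  ∃ q', IsOpenProjection A q' ∧ IsCompactlyContained A q' q ∧ PZEquiv A p q'

/-- The multiplier algebra of `A`, concretely realized (for a nondegenerate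
representation) as the idealizer of `A` in `B(H)`. -/
def multiplierSet (A : Set (H →L[ℂ] H)) : Set (H →L[ℂ] H) :=
  {x | ∀ a ∈ A, x * a ∈ A ∧ a * x ∈ A}

/-- Convergence of a net of operators in the strict topology determined by `A`. -/
def StrictTendsto (A : Set (H →L[ℂ] H)) {ι : Type*} (le : ι → ι → Prop)
    (a : ι → H →L[ℂ] H) (x : H →L[ℂ] H) : Prop :=
  ∀ b ∈ A, ∀ ε : ℝ, 0 < ε → ∃ i, ∀ j, le i j →
    ‖a j * b - x * b‖ < ε ∧ ‖b * a j - b * x‖ < ε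

/-- `A` is stable (i.e. of the form `A₀ ⊗ K`): there is a sequence of isometries in
`M(A)` with pairwise orthogonal ranges adding up strictly to the identity. -/
def IsStableAlg (A : Set (H →L[ℂ] H)) : Prop :=
  ∃ s : ℕ → H →L[ℂ] H, (∀ n, s n ∈ multiplierSet A) ∧
    (∀ n, star (s n) * s n = 1) ∧ (∀ m n, m ≠ n → star (s m) * s n = 0) ∧
    StrictTendsto A (· ≤ ·) (fun N => ∑ n ∈ Finset.range N, s n * star (s n)) 1

/-- A *-isomorphism between two (concrete) C*-algebras given as subsets of `B(H)`. -/
def StarAlgEquivOn (S T : Set (H →L[ℂ] H)) : Prop :=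
  ∃ f : (H →L[ℂ] H) → (H →L[ℂ] H), Set.BijOn f S T ∧
    (∀ x ∈ S, ∀ y ∈ S, f (x + y) = f x + f y) ∧
    (∀ x ∈ S, ∀ y ∈ S, f (x * y) = f x * f y) ∧
    (∀ (c : ℂ), ∀ x ∈ S, f (c • x) = c • f x) ∧
    ∀ x ∈ S, f (star x) = star (f x)

/-- A hereditary sub-C*-algebra of `A`. -/
def IsHereditarySubalg (A C : Set (H →L[ℂ] H)) : Prop :=
  C ⊆ A ∧ IsClosed C ∧ (0 : H →L[ℂ] H) ∈ C ∧
    (∀ x ∈ C, ∀ y ∈ C, x + y ∈ C) ∧ (∀ (c : ℂ), ∀ x ∈ C, c • x ∈ C) ∧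
    (∀ x ∈ C, ∀ y ∈ C, x * y ∈ C) ∧ (∀ x ∈ C, star x ∈ C) ∧
    ∀ x ∈ C, ∀ a ∈ A, ∀ y ∈ C, x * a * y ∈ C


/-- scalar sequence -/
noncomputable def rho : ℕ → ℝ → ℝ
  | 0, _ => 1
  | n + 1, t => rho n t - rho n t * rho n t * (t * t)

/-- operator sequence -/
noncomputable def rr (k : H →L[ℂ] H) : ℕ → (H →L[ℂ] H)
  | 0 => 1
  | n + 1 => rr k n - rr k n * rr k n * (k * k)

lemma rho_cont (n : ℕ) : Continuous (rho n) := by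
  induction n with
  | zero => simpa [rho] using (continuous_const : Continuous (fun _ : ℝ => (1 : ℝ)))
  | succ n ih =>
    have : rho (n + 1) = fun t => rho n t - rho n t * rho n t * (t * t) := rfl
    rw [this]; fun_prop

lemma rho_bd (n : ℕ) (t : ℝ) (ht : |t| ≤ 1) : 0 ≤ rho n t ∧ rho n t ≤ 1 := by
  have h2 : t * t ≤ 1 := by nlinarith [abs_le.1 ht, sq_nonneg t, sq_abs t, abs_nonneg t]
  induction n with
  | zero => simp [rho]
  | succ n ih =>
    obtain ⟨h0, h1⟩ := ih
    have h3 : rho n t * (t * t) ≤ 1 := by nlinarith [mul_self_nonneg t]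
    simp only [rho]
    constructor
    · nlinarith [mul_nonneg h0 (sub_nonneg.2 h3)]
    · nlinarith [mul_nonneg (mul_self_nonneg (rho n t)) (mul_self_nonneg t)]

lemma rho_anti (n : ℕ) (t : ℝ) : rho (n + 1) t ≤ rho n t := by
  simp only [rho]
  nlinarith [mul_nonneg (mul_self_nonneg (rho n t)) (mul_self_nonneg t)]

lemma rho_sum (n : ℕ) (t : ℝ) (ht : |t| ≤ 1) :
    n * (rho n t * t) ^ 2 ≤ 1 - rho n t := by
  induction n with
  | zero => simp [rho]
  | succ n ih =>
    have h0 := (rho_bd n t ht).1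
    have h0' := (rho_bd (n + 1) t ht).1
    have ha := rho_anti n t
    have h1 : (rho (n + 1) t * t) ^ 2 ≤ (rho n t * t) ^ 2 := by
      rw [mul_pow, mul_pow]; gcongr
    have h2 : rho (n + 1) t = rho n t - (rho n t * t) ^ 2 := by
      simp only [rho]; ring
    push_cast
    have : (n : ℝ) * (rho (n + 1) t * t) ^ 2 ≤ n * (rho n t * t) ^ 2 := by gcongr
    nlinarith

lemma rr_eq (k : H →L[ℂ] H) (hk : IsSelfAdjoint k) (n : ℕ) : rr k n = cfc (rho n) k := by
  induction n with
  | zero =>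
    have : rho 0 = fun _ => 1 := rfl
    rw [this]; simp only [rr]; exact (cfc_const_one ℝ k).symm
  | succ n ih =>
    have h1 : rho (n + 1) = fun t => rho n t - (fun t => (fun t => rho n t * rho n t) t * (fun t => t * t) t) t := rfl
    have hc := rho_cont n
    rw [h1, cfc_sub _ _ k (by fun_prop) (by fun_prop), cfc_mul _ _ k (by fun_prop) (by fun_prop),
      cfc_mul _ _ k (by fun_prop) (by fun_prop), cfc_mul _ _ k (by fun_prop) (by fun_prop),
      cfc_id' ℝ k, rr, ih]

lemma spec_bd (k : H →L[ℂ] H) (hk1 : ‖k‖ ≤ 1) (t : ℝ) (ht : t ∈ spectrum ℝ k) : |t| ≤ 1 := by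
  have h := spectrum.norm_le_norm_mul_of_mem ht
  have h1 : ‖(1 : H →L[ℂ] H)‖ ≤ 1 := ContinuousLinearMap.norm_id_le
  rw [Real.norm_eq_abs] at h
  nlinarith [norm_nonneg k, norm_nonneg (1 : H →L[ℂ] H)]

lemma rr_sa (k : H →L[ℂ] H) (hk : IsSelfAdjoint k) (n : ℕ) : star (rr k n) = rr k n := by
  rw [rr_eq k hk]; exact (IsSelfAdjoint.cfc : IsSelfAdjoint (cfc (rho n) k)).star_eq

lemma rr_nonneg (k : H →L[ℂ] H) (hk : IsSelfAdjoint k) (hk1 : ‖k‖ ≤ 1) (n : ℕ) : 0 ≤ rr k n := by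
  rw [rr_eq k hk]; exact cfc_nonneg fun t ht => (rho_bd n t (spec_bd k hk1 t ht)).1

lemma rr_norm (k : H →L[ℂ] H) (hk : IsSelfAdjoint k) (hk1 : ‖k‖ ≤ 1) (n : ℕ) : ‖rr k n‖ ≤ 1 := by
  rw [rr_eq k hk]
  refine norm_cfc_le zero_le_one fun t ht => ?_
  have := rho_bd n t (spec_bd k hk1 t ht)
  rw [Real.norm_eq_abs, abs_of_nonneg this.1]; exact this.2

lemma rr_anti (k : H →L[ℂ] H) (hk : IsSelfAdjoint k) : Antitone (rr k) := by
  refine antitone_nat_of_succ_le fun n => ?_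
  rw [rr_eq k hk, rr_eq k hk]
  exact cfc_mono (fun t _ => rho_anti n t) (rho_cont _).continuousOn (rho_cont _).continuousOn

lemma rr_mul_norm (k : H →L[ℂ] H) (hk : IsSelfAdjoint k) (hk1 : ‖k‖ ≤ 1) (n : ℕ) :
    ‖rr k (n + 1) * k‖ ≤ 1 / √((n : ℝ) + 1) := by
  have hc := rho_cont (n + 1)
  have : rr k (n + 1) * k = cfc (fun t => rho (n + 1) t * t) k := by
    rw [cfc_mul _ _ k (by fun_prop) (by fun_prop), cfc_id' ℝ k, rr_eq k hk]
  rw [this]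
  refine norm_cfc_le (by positivity) fun t ht => ?_
  have hb := spec_bd k hk1 t ht
  have h1 := rho_sum (n + 1) t hb
  have h2 := (rho_bd (n + 1) t hb).1
  have hn' : (0 : ℝ) < (n : ℝ) + 1 := by positivity
  rw [Real.norm_eq_abs]
  refine abs_le_of_sq_le_sq ?_ (by positivity)
  rw [div_pow, Real.sq_sqrt hn'.le, one_pow, le_div_iff₀ hn']
  push_cast at h1
  nlinarith

lemma rr_mul_tendsto (k : H →L[ℂ] H) (hk : IsSelfAdjoint k) (hk1 : ‖k‖ ≤ 1) :
    Tendsto (fun n => ‖rr k n * k‖) atTop (𝓝 0) := by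
  rw [← tendsto_add_atTop_iff_nat 1]
  refine squeeze_zero (fun n => norm_nonneg _) (fun n => rr_mul_norm k hk hk1 n) ?_
  have h : Tendsto (fun n : ℕ => (n : ℝ) + 1) atTop atTop :=
    tendsto_atTop_add_const_right _ _ tendsto_natCast_atTop_atTop
  have := tendsto_inv_atTop_zero.comp (Real.tendsto_sqrt_atTop.comp h)
  simpa [Function.comp_def] using this

lemma rr_comm (k : H →L[ℂ] H) (n : ℕ) : Commute (rr k n) k := by
  induction n with
  | zero => exact Commute.one_left k
  | succ n ih =>
    exact ih.sub_left ((ih.mul_left ih).mul_left ((Commute.refl k).mul_left (Commute.refl k)))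

lemma rr_step (k : H →L[ℂ] H) (n : ℕ) :
    rr k (n + 1) = rr k n - (rr k n * k) * (rr k n * k) := by
  have h := (rr_comm k n).eq
  simp only [rr]
  congr 1
  calc rr k n * rr k n * (k * k) = rr k n * (rr k n * k) * k := by noncomm_ring
    _ = rr k n * (k * rr k n) * k := by rw [h]
    _ = _ := by noncomm_ring

lemma rr_fix (k : H →L[ℂ] H) (n : ℕ) (x : H) (hx : k x = 0) : rr k n x = x := by
  induction n with
  | zero => simp [rr]
  | succ n ih => simp [rr, hx, ih]

lemma rr_mem (B : Set (H →L[ℂ] H)) (hB : IsCStarSubalg B) (k : H →L[ℂ] H) (hk : k ∈ B) (n : ℕ) :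
    1 - rr k n ∈ B ∧ rr k n * k ∈ B := by
  obtain ⟨h0, hadd, hsm, hmul, hst, hcl⟩ := hB
  have key : ∀ n, 1 - rr k n ∈ B → rr k n * k ∈ B := by
    intro n h
    have := hadd _ hk _ (hsm (-1) _ (hmul _ h _ hk))
    convert this using 1
    simp [sub_mul]
  have : 1 - rr k n ∈ B := by
    induction n with
    | zero => simpa [rr] using h0
    | succ n ih =>
      have h1 := key n ih
      rw [rr_step]
      have := hadd _ ih _ (hmul _ h1 _ h1)
      convert this using 1
      abel
  exact ⟨this, key n this⟩

lemma ip_star (a : H →L[ℂ] H) (x y : H) : inner ℂ (star a x) y = inner ℂ x (a y) := by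
  rw [ContinuousLinearMap.star_eq_adjoint, ContinuousLinearMap.adjoint_inner_left]

lemma ker_mul (p k : H →L[ℂ] H) (hp : IsProjectionOp p) (hk : IsSelfAdjoint k)
    (h : ∀ x, p x = 0 → k x = 0) : k * p = k ∧ p * k = k := by
  have h1 : k * p = k := by
    ext x
    have := h (x - p x) (by
      have h2 : p (p x) = p x := congrArg (fun T : H →L[ℂ] H => T x) hp.2
      rw [map_sub, h2, sub_self])
    rw [map_sub, sub_eq_zero] at this
    exact this.symm
  refine ⟨h1, ?_⟩
  have := congrArg star h1
  rwa [star_mul, hp.1.star_eq, hk.star_eq] at this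

lemma rr_sot (p k : H →L[ℂ] H) (hp : IsProjectionOp p) (hk : IsSelfAdjoint k) (hk1 : ‖k‖ ≤ 1)
    (h : ∀ x, k x = 0 ↔ p x = 0) (x : H) :
    Tendsto (fun n => rr k n x) atTop (𝓝 (x - p x)) := by
  have h2 : p (p x) = p x := congrArg (fun T : H →L[ℂ] H => T x) hp.2
  have hz : Tendsto (fun n => rr k n (p x)) atTop (𝓝 0) := by
    have hmem : p x ∈ ((k : H →ₗ[ℂ] H).ker)ᗮ := by
      rw [Submodule.mem_orthogonal]
      intro u hu
      have hu' : p u = 0 := (h u).1 hu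
      rw [← ip_star, hp.1.star_eq, hu', inner_zero_left]
    rw [ContinuousLinearMap.orthogonal_ker, ← ContinuousLinearMap.star_eq_adjoint, hk.star_eq] at hmem
    have hmem' : p x ∈ closure (Set.range k) := hmem
    rw [Metric.tendsto_atTop]
    intro ε hε
    obtain ⟨_, ⟨y, rfl⟩, hy⟩ := Metric.mem_closure_iff.1 hmem' (ε / 2) (by positivity)
    have h3 : Tendsto (fun n => ‖rr k n * k‖ * ‖y‖) atTop (𝓝 0) := by
      simpa using (rr_mul_tendsto k hk hk1).mul_const ‖y‖
    obtain ⟨N, hN⟩ := (h3.eventually (gt_mem_nhds (show (0 : ℝ) < ε / 2 by positivity))).exists_forall_of_atTop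
    refine ⟨N, fun n hn => ?_⟩
    have h4 : rr k n (p x) = rr k n (p x - k y) + (rr k n * k) y := by simp
    rw [dist_zero_right, h4]
    calc _ ≤ ‖rr k n (p x - k y)‖ + ‖(rr k n * k) y‖ := norm_add_le _ _
      _ ≤ 1 * ‖p x - k y‖ + ‖rr k n * k‖ * ‖y‖ := by
        gcongr
        · exact (rr k n).le_of_opNorm_le (rr_norm k hk hk1 n) _
        · exact ContinuousLinearMap.le_opNorm _ _
      _ < ε := by
        rw [dist_eq_norm] at hy
        linarith [hN n hn]
  have h5 : ∀ n, rr k n x = rr k n (p x) + (x - p x) := by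
    intro n
    have := rr_fix k n (x - p x) ((h _).2 (by rw [map_sub, h2, sub_self]))
    rw [map_sub, sub_eq_iff_eq_add] at this
    rw [this, add_comm]
  simp_rw [h5]
  simpa using hz.add_const (x - p x)

lemma open_of_ker' (B : Set (H →L[ℂ] H)) (hB : IsCStarSubalg B) (p k : H →L[ℂ] H)
    (hp : IsProjectionOp p) (hkB : k ∈ B) (hk : IsSelfAdjoint k) (hk1 : ‖k‖ ≤ 1)
    (h : ∀ x, k x = 0 ↔ p x = 0) : IsOpenProjection B p := by
  refine ⟨hp, ℕ, (· ≤ ·), fun n => 1 - rr k n, ⟨0⟩, fun i => le_rfl, fun i j k => le_trans,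
    fun i j => ⟨max i j, le_max_left _ _, le_max_right _ _⟩, fun i => (rr_mem B hB k hkB i).1,
    fun i => ?_, fun i j hij => ?_, fun x ε hε => ?_⟩
  · have : rr k i ≤ rr k 0 := rr_anti k hk (Nat.zero_le i)
    exact this
  · have h1 : rr k j ≤ rr k i := rr_anti k hk hij
    have : 1 - rr k i ≤ 1 - rr k j := sub_le_sub_left h1 1
    exact this
  · obtain ⟨N, hN⟩ := Metric.tendsto_atTop.1 (rr_sot p k hp hk hk1 h x) ε hε
    refine ⟨N, fun j hj => ?_⟩
    have := hN j hj
    rw [dist_eq_norm, ← norm_neg] at this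
    have e : (1 - rr k j) x - p x = -(rr k j x - (x - p x)) := by
      rw [sub_apply, ContinuousLinearMap.one_apply]; abel
    change ‖(1 - rr k j) x - p x‖ < ε
    rw [e]; exact this

lemma open_of_ker (B : Set (H →L[ℂ] H)) (hB : IsCStarSubalg B) (p k : H →L[ℂ] H)
    (hp : IsProjectionOp p) (hkB : k ∈ B) (hk : IsSelfAdjoint k)
    (h : ∀ x, k x = 0 ↔ p x = 0) : IsOpenProjection B p := by
  have hpos : (0 : ℝ) < ‖k‖ + 1 := by positivity
  refine open_of_ker' B hB p (((‖k‖ + 1)⁻¹ : ℝ) • k) hp ?_ ?_ ?_ fun x => ?_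
  · have := hB.2.2.1 (((‖k‖ + 1)⁻¹ : ℝ) : ℂ) k hkB
    rwa [Complex.coe_smul] at this
  · exact IsSelfAdjoint.smul (IsSelfAdjoint.all _) hk
  · rw [norm_smul, Real.norm_of_nonneg (by positivity), inv_mul_le_iff₀ hpos]
    linarith
  · rw [← h x]
    simp [hpos.ne']

lemma strictpos (B : Set (H →L[ℂ] H)) (hB : IsCStarSubalg B)
    (hsep : TopologicalSpace.IsSeparable B) (p : H →L[ℂ] H) :
    ∃ k ∈ B, 0 ≤ k ∧ ‖k‖ ≤ 1 ∧ p * k = k ∧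
      ∀ y ∈ B, p * y = y → Tendsto (fun n => ‖rr k n * y‖) atTop (𝓝 0) := by
  obtain ⟨h0, hadd, hsm, hmul, hst, hcl⟩ := hB
  let R : Set (H →L[ℂ] H) := {y | y ∈ B ∧ p * y = y}
  have hRsep : TopologicalSpace.IsSeparable R := hsep.mono fun y hy => hy.1
  obtain ⟨D, hDR, hDc, hDd⟩ := hRsep.exists_countable_dense_subset
  have h0R : (0 : H →L[ℂ] H) ∈ R := ⟨h0, mul_zero _⟩
  have hDne : D.Nonempty := by
    rw [← closure_nonempty_iff]; exact ⟨0, hDd h0R⟩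
  obtain ⟨y, rfl⟩ := hDc.exists_eq_range hDne
  have hyR : ∀ n, y n ∈ R := fun n => hDR ⟨n, rfl⟩
  let c : ℕ → ℝ := fun n => (1 / 2) ^ (n + 1) / (1 + ‖y n‖ * ‖y n‖)
  have hc : ∀ n, 0 < c n := fun n => by positivity
  let f : ℕ → H →L[ℂ] H := fun n => c n • (y n * star (y n))
  have hfn : ∀ n, ‖f n‖ ≤ (1 / 2) ^ (n + 1) := by
    intro n
    simp only [f]
    rw [norm_smul, Real.norm_of_nonneg (hc n).le, CStarRing.norm_self_mul_star]
    simp only [c]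
    rw [div_mul_eq_mul_div, div_le_iff₀ (by positivity)]
    gcongr
    linarith
  have hg : HasSum (fun n : ℕ => ((1 : ℝ) / 2) ^ (n + 1)) 1 := by
    have := hasSum_geometric_two.mul_left (1 / 2 : ℝ)
    simpa [pow_succ, mul_comm] using this
  have hfs : Summable f := Summable.of_norm_bounded hg.summable hfn
  have hf0 : ∀ n, 0 ≤ f n := fun n => smul_nonneg (hc n).le (mul_star_self_nonneg (y n))
  have hfB : ∀ n, f n ∈ B := by
    intro n
    have := hsm (c n : ℂ) _ (hmul _ (hyR n).1 _ (hst _ (hyR n).1))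
    rwa [Complex.coe_smul] at this
  have hk0 : 0 ≤ ∑' n, f n := tsum_nonneg hf0
  have hk1 : ‖∑' n, f n‖ ≤ 1 := tsum_of_norm_bounded hg hfn
  refine ⟨∑' n, f n, ?_, hk0, hk1, ?_, ?_⟩
  · refine hcl.mem_of_tendsto hfs.hasSum (Eventually.of_forall fun s => ?_)
    exact Finset.sum_induction f (· ∈ B) (fun a b ha hb => hadd a ha b hb) h0 fun n _ => hfB n
  · rw [← hfs.tsum_mul_left]
    congr 1
    ext1 n
    simp only [f]
    rw [mul_smul_comm, ← mul_assoc, (hyR n).2]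
  · set k := ∑' n, f n with hkdef
    have hksa : IsSelfAdjoint k := IsSelfAdjoint.of_nonneg hk0
    have step : ∀ m, Tendsto (fun n => ‖rr k n * y m‖) atTop (𝓝 0) := by
      intro m
      have hle : f m ≤ k := hfs.le_tsum m fun j _ => hf0 j
      have hb : ∀ n, ‖rr k n * y m‖ ^ 2 ≤ (c m)⁻¹ * ‖rr k n * k‖ := by
        intro n
        have h1 : rr k n * f m * rr k n ≤ rr k n * k * rr k n := by
          have := star_left_conjugate_le_conjugate hle (rr k n)
          rwa [rr_sa k hksa] at this
        have h2 : 0 ≤ rr k n * f m * rr k n := by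
          have := star_left_conjugate_nonneg (hf0 m) (rr k n)
          rwa [rr_sa k hksa] at this
        have h3 := CStarAlgebra.norm_le_norm_of_nonneg_of_le h2 h1
        have h4 : rr k n * f m * rr k n = c m • ((rr k n * y m) * star (rr k n * y m)) := by
          simp only [f]
          rw [star_mul, rr_sa k hksa, mul_smul_comm, smul_mul_assoc]
          simp only [mul_assoc]
        rw [h4, norm_smul, Real.norm_of_nonneg (hc m).le, CStarRing.norm_self_mul_star] at h3
        have h5 : ‖rr k n * k * rr k n‖ ≤ ‖rr k n * k‖ :=
          (norm_mul_le _ _).trans (mul_le_of_le_one_right (norm_nonneg _) (rr_norm k hksa hk1 n))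
        rw [inv_mul_eq_div, le_div_iff₀ (hc m)]
        linarith
      have h6 : Tendsto (fun n => ‖rr k n * y m‖ ^ 2) atTop (𝓝 0) := by
        refine squeeze_zero (fun n => by positivity) hb ?_
        simpa using (rr_mul_tendsto k hksa hk1).const_mul (c m)⁻¹
      have := h6.sqrt
      simpa using this
    intro z hz hpz
    rw [Metric.tendsto_atTop]
    intro ε hε
    obtain ⟨_, ⟨m, rfl⟩, hm⟩ := Metric.mem_closure_iff.1 (hDd ⟨hz, hpz⟩) (ε / 2) (by positivity)
    obtain ⟨N, hN⟩ := Metric.tendsto_atTop.1 (step m) (ε / 2) (by positivity)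
    refine ⟨N, fun n hn => ?_⟩
    have h7 := hN n hn
    rw [dist_zero_right, norm_norm] at h7 ⊢
    have h8 : rr k n * z = rr k n * (z - y m) + rr k n * y m := by noncomm_ring
    rw [h8]
    calc _ ≤ ‖rr k n * (z - y m)‖ + ‖rr k n * y m‖ := norm_add_le _ _
      _ ≤ 1 * ‖z - y m‖ + ‖rr k n * y m‖ := by
        gcongr
        exact (norm_mul_le _ _).trans (by gcongr; exact rr_norm k hksa hk1 n)
      _ < ε := by rw [dist_eq_norm] at hm; linarith

lemma ker_kill (k y : H →L[ℂ] H) (hk : IsSelfAdjoint k)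
    (h : Tendsto (fun n => ‖rr k n * y‖) atTop (𝓝 0)) (x : H) (hx : k x = 0) : star y x = 0 := by
  have h1 : ∀ n, star y x = star (rr k n * y) x := by
    intro n
    rw [star_mul, rr_sa k hk]
    simp [rr_fix k n x hx]
  have h2 : ∀ n, ‖star y x‖ ≤ ‖rr k n * y‖ * ‖x‖ := by
    intro n
    have := ContinuousLinearMap.le_opNorm (star (rr k n * y)) x
    rwa [norm_star, ← h1] at this
  have h3 : Tendsto (fun n => ‖rr k n * y‖ * ‖x‖) atTop (𝓝 0) := by simpa using h.mul_const ‖x‖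
  have := ge_of_tendsto' h3 h2
  exact norm_le_zero_iff.1 this

lemma exists_full (B : Set (H →L[ℂ] H)) (hB : IsCStarSubalg B)
    (hsep : TopologicalSpace.IsSeparable B) (hnd : Nondegenerate B) :
    ∃ h ∈ B, 0 ≤ h ∧ ∀ x, h x = 0 → x = 0 := by
  obtain ⟨k, hkB, hk0, hk1, -, hk⟩ := strictpos B hB hsep 1
  refine ⟨k, hkB, hk0, fun x hx => ?_⟩
  by_contra hne
  obtain ⟨a, ha, hax⟩ := hnd x ‖x‖ (norm_pos_iff.2 hne)
  have := ker_kill k (star a) (IsSelfAdjoint.of_nonneg hk0)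
    (hk _ (hB.2.2.2.2.1 a ha) (one_mul _)) x hx
  rw [star_star] at this
  rw [this, zero_sub, norm_neg] at hax
  exact lt_irrefl _ hax

lemma pos_kill (a : H →L[ℂ] H) (ha : 0 ≤ a) (x : H)
    (hx : (inner ℂ (a x) x).re ≤ 0) : a x = 0 := by
  obtain ⟨b, rfl⟩ := CStarAlgebra.nonneg_iff_eq_star_mul_self.1 ha
  have h4 : inner ℂ ((star b * b) x) x = inner ℂ (b x) (b x) := ip_star b (b x) x
  rw [h4, inner_self_eq_norm_sq_to_K] at hx
  have h6 : ‖b x‖ ^ 2 ≤ 0 := by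
    simp at hx
    norm_cast at hx
  have h7 : b x = 0 := by
    have : ‖b x‖ = 0 := by nlinarith [norm_nonneg (b x)]
    exact norm_eq_zero.1 this
  simp [h7]

lemma le_re (a b : H →L[ℂ] H) (h : a ≤ b) (x : H) :
    (inner ℂ (a x) x).re ≤ (inner ℂ (b x) x).re := by
  have h1 : 0 ≤ (b - a) := sub_nonneg.2 h
  have h2 := ((ContinuousLinearMap.nonneg_iff_isPositive _).1 h1).re_inner_nonneg_left x
  rw [sub_apply, inner_sub_left, map_sub] at h2
  exact sub_nonneg.1 h2

lemma le_kill (a p : H →L[ℂ] H) (ha : 0 ≤ a) (hap : a ≤ p) (x : H)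
    (hx : p x = 0) : a x = 0 := by
  refine pos_kill a ha x ((le_re a p hap x).trans ?_)
  simp [hx]

lemma ker_of_open (B : Set (H →L[ℂ] H)) (hB : IsCStarSubalg B)
    (hsep : TopologicalSpace.IsSeparable B) (p : H →L[ℂ] H) (hp : IsOpenProjection B p) :
    ∃ k ∈ B, 0 ≤ k ∧ ‖k‖ ≤ 1 ∧ (∀ x, k x = 0 ↔ p x = 0) ∧
      ∀ y ∈ B, p * y = y → Tendsto (fun n => ‖rr k n * y‖) atTop (𝓝 0) := by
  obtain ⟨k, hkB, hk0, hk1, hpk, hk⟩ := strictpos B hB hsep p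
  have hsa : IsSelfAdjoint k := IsSelfAdjoint.of_nonneg hk0
  refine ⟨k, hkB, hk0, hk1, fun x => ⟨fun hx => ?_, fun hx => ?_⟩, hk⟩
  · obtain ⟨hpp, ι, le, a, hne, hrefl, htr, hdir, haB, hapos, hmono, hlim⟩ := hp
    have hle : ∀ i, ∀ x, p x = 0 → a i x = 0 := by
      intro i x hx
      refine pos_kill _ ((ContinuousLinearMap.nonneg_iff_isPositive _).2 (hapos i)) x ?_
      refine le_of_forall_pos_le_add fun ε hε => ?_
      obtain ⟨j, hj⟩ := hlim x (ε / (‖x‖ + 1)) (by positivity)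
      obtain ⟨l, hil, hjl⟩ := hdir i j
      have h1 := hj l hjl
      rw [hx, sub_zero, lt_div_iff₀ (by positivity)] at h1
      have h2 := le_re (a i) (a l) (hmono i l hil) x
      have h3 : (inner ℂ (a l x) x).re ≤ ‖a l x‖ * ‖x‖ :=
        (Complex.re_le_norm _).trans (norm_inner_le_norm _ _)
      nlinarith [norm_nonneg (a l x)]
    have hzero : ∀ i, a i x = 0 := by
      intro i
      have h1 := ker_mul p (a i) hpp (hapos i).isSelfAdjoint (hle i)
      have := ker_kill k (a i) hsa (hk _ (haB i) h1.2) x hx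
      rwa [(hapos i).isSelfAdjoint.star_eq] at this
    by_contra hpx
    obtain ⟨i, hi⟩ := hlim x ‖p x‖ (norm_pos_iff.2 hpx)
    have := hi i (hrefl i)
    rw [hzero, zero_sub, norm_neg] at this
    exact lt_irrefl _ this
  · have : k * p = k := by
      have := congrArg star hpk
      rwa [star_mul, hp.1.1.star_eq, hsa.star_eq] at this
    rw [← this]; simp [hx]

lemma conj_kill (h m : H →L[ℂ] H) (hh : 0 ≤ h) (x : H) (hx : (star m * h * m) x = 0) :
    h (m x) = 0 := by
  refine pos_kill h hh (m x) ?_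
  have : inner ℂ (h (m x)) (m x) = inner ℂ ((star m * h * m) x) x :=
    (ip_star m (h (m x)) x).symm
  rw [this, hx]; simp

lemma proj_le (p q : H →L[ℂ] H) (hp : IsProjectionOp p) (hq : IsProjectionOp q)
    (h : q * p = p) : p ≤ q := by
  have h' : p * q = p := by
    have := congrArg star h
    rwa [star_mul, hp.1.star_eq, hq.1.star_eq] at this
  have : q - p = star (q - p) * (q - p) := by
    rw [star_sub, hp.1.star_eq, hq.1.star_eq, mul_sub, sub_mul, sub_mul, hp.2.eq, hq.2.eq, h, h']
    abel
  rw [← sub_nonneg, this]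
  exact star_mul_self_nonneg _

lemma proj_of_le (p q : H →L[ℂ] H) (hp : IsProjectionOp p) (hq : IsProjectionOp q)
    (h : p ≤ q) : p * q = p ∧ q * p = p := by
  have h0 : 0 ≤ p := by
    have : p = star p * p := by rw [hp.1.star_eq, hp.2.eq]
    rw [this]; exact star_mul_self_nonneg _
  exact ker_mul q p hq hp.1 (le_kill p q h0 h)

lemma proj_compl (p : H →L[ℂ] H) (hp : IsProjectionOp p) : IsProjectionOp (1 - p) :=
  ⟨(IsSelfAdjoint.one _).sub hp.1, hp.2.one_sub⟩

lemma trans_proj (v p c : H →L[ℂ] H) (h1 : star v * v = p) (hc : IsProjectionOp c)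
    (hpc : p * c = c) : IsProjectionOp (v * c * star v) := by
  constructor
  · rw [isSelfAdjoint_iff, star_mul, star_mul, star_star, hc.1.star_eq, mul_assoc]
  · change v * c * star v * (v * c * star v) = v * c * star v
    calc v * c * star v * (v * c * star v) = v * (c * ((star v * v) * c)) * star v := by noncomm_ring
      _ = _ := by rw [h1, hpc, hc.2.eq]

lemma vp (v p : H →L[ℂ] H) (hp : IsProjectionOp p) (h1 : star v * v = p) : v * p = v := by
  have : star (v * p - v) * (v * p - v) = 0 := by
    rw [star_sub, star_mul, hp.1.star_eq]
    calc (p * star v - star v) * (v * p - v)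
        = p * (star v * v) * p - p * (star v * v) - (star v * v) * p + star v * v := by noncomm_ring
      _ = 0 := by rw [h1, hp.2.eq, hp.2.eq]; abel
  exact sub_eq_zero.1 (CStarRing.star_mul_self_eq_zero_iff _ |>.1 this)

lemma trans_closed (B : Set (H →L[ℂ] H)) (hB : IsCStarSubalg B)
    (hsep : TopologicalSpace.IsSeparable B) (hnd : Nondegenerate B)
    (v p c a : H →L[ℂ] H) (hp : IsProjectionOp p) (h1 : star v * v = p)
    (hv : ∀ a ∈ her B p, v * a ∈ B) (hc : IsClosedProjection B c) (ha : a ∈ her B p)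
    (hsa : IsSelfAdjoint a) (hca : c * a = c) (hb : v * a * star v ∈ B) :
    IsClosedProjection B (v * c * star v) := by
  obtain ⟨h, hhB, hh0, hhk⟩ := exists_full B hB hsep hnd
  obtain ⟨k, hkB, hk0, -, hkk, -⟩ := ker_of_open B hB hsep _ hc.2
  obtain ⟨h0, hadd, hsm, hmul, hst, hcl⟩ := id hB
  have hap : a * p = a := by
    have := ha.2
    calc a * p = (p * a * p) * p := by rw [this]
      _ = p * a * (p * p) := by noncomm_ring
      _ = a := by rw [hp.2.eq, this]
  have hpa : p * a = a := by
    have := congrArg star hap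
    rwa [star_mul, hp.1.star_eq, hsa.star_eq] at this
  have hac : a * c = c := by
    have := congrArg star hca
    rwa [star_mul, hc.1.1.star_eq, hsa.star_eq] at this
  have hpc : p * c = c := by rw [← hac, ← mul_assoc, hpa]
  have hd := trans_proj v p c h1 hc.1 hpc
  refine ⟨hd, ?_⟩
  set b := v * a * star v with hbdef
  have hbsa : star b = b := by
    rw [hbdef, star_mul, star_mul, star_star, hsa.star_eq, mul_assoc]
  have h1bsa : star (1 - b) = 1 - b := by rw [star_sub, star_one, hbsa]
  have hT1 : (0 : H →L[ℂ] H) ≤ star (1 - b) * h * (1 - b) := star_left_conjugate_nonneg hh0 _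
  have hT2 : (0 : H →L[ℂ] H) ≤ star (star (v * a)) * k * star (v * a) :=
    star_left_conjugate_nonneg hk0 _
  have hneg : ∀ z ∈ B, -z ∈ B := fun z hz => by simpa using hsm (-1) z hz
  have hvaB := hv a ha
  refine open_of_ker B hB _ (star (1 - b) * h * (1 - b) + star (star (v * a)) * k * star (v * a))
    (proj_compl _ hd) ?_ (IsSelfAdjoint.of_nonneg (add_nonneg hT1 hT2)) fun x => ⟨fun hx => ?_, fun hx => ?_⟩
  · refine hadd _ ?_ _ ?_
    · have e : star (1 - b) * h * (1 - b) = h + -(b * h) + (-(h * b) + b * h * b) := by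
        rw [h1bsa]; noncomm_ring
      rw [e]
      exact hadd _ (hadd _ hhB _ (hneg _ (hmul _ hb _ hhB))) _
        (hadd _ (hneg _ (hmul _ hhB _ hb)) _ (hmul _ (hmul _ hb _ hhB) _ hb))
    · rw [star_star]
      exact hmul _ (hmul _ hvaB _ hkB) _ (hst _ hvaB)
  · have e1 := hhk _ (conj_kill h _ hh0 x (le_kill _ _ hT1 (le_add_of_nonneg_right hT2) x hx))
    have e2 := conj_kill k _ hk0 x (le_kill _ _ hT2 (le_add_of_nonneg_left hT1) x hx)
    have e3 : b x = x := by
      rw [sub_apply, ContinuousLinearMap.one_apply, sub_eq_zero] at e1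
      exact e1.symm
    have e4 : a (star v x) = star v x := by
      have : star v * b = a * star v := by
        calc star v * b = (star v * v) * a * star v := by rw [hbdef]; noncomm_ring
          _ = _ := by rw [h1, hpa]
      calc a (star v x) = (a * star v) x := rfl
        _ = star v (b x) := by rw [← this]; rfl
        _ = _ := by rw [e3]
    have e5 : k (star v x) = 0 := by
      rw [star_mul, hsa.star_eq] at e2
      have : k (a (star v x)) = 0 := e2
      rwa [e4] at this
    have e6 : c (star v x) = star v x := by
      have := (hkk _).1 e5
      rw [sub_apply, ContinuousLinearMap.one_apply, sub_eq_zero] at this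
      exact this.symm
    have e7 : v (star v x) = x := by
      calc v (star v x) = v (a (star v x)) := by rw [e4]
        _ = b x := rfl
        _ = x := e3
    have e8 : (v * c * star v) x = x := by
      change v (c (star v x)) = x
      rw [e6, e7]
    rw [sub_apply, ContinuousLinearMap.one_apply, e8, sub_self]
  · have hx' : x = (v * c * star v) x := by
      rw [sub_apply, ContinuousLinearMap.one_apply, sub_eq_zero] at hx
      exact hx
    have e1 : (1 - b) * (v * c * star v) = 0 := by
      calc (1 - b) * (v * c * star v) = v * c * star v - v * (a * ((star v * v) * c)) * star v := by
            rw [hbdef]; noncomm_ring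
        _ = 0 := by rw [h1, hpc, hac, sub_self]
    have hkc : k * c = 0 := by
      ext y
      refine (hkk (c y)).2 ?_
      have : c (c y) = c y := congrArg (fun T : H →L[ℂ] H => T y) hc.1.2
      rw [sub_apply, ContinuousLinearMap.one_apply, this, sub_self]
    have e2 : k * star (v * a) * (v * c * star v) = 0 := by
      rw [star_mul, hsa.star_eq]
      calc k * (a * star v) * (v * c * star v) = k * (a * ((star v * v) * c)) * star v := by noncomm_ring
        _ = 0 := by rw [h1, hpc, hac, hkc, zero_mul]
    have e3 : (star (1 - b) * h * (1 - b) + star (star (v * a)) * k * star (v * a)) * (v * c * star v) = 0 := by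
      rw [add_mul, mul_assoc _ (1 - b), e1, mul_zero, mul_assoc _ k, mul_assoc _ (k * star (v * a)), e2,
        mul_zero, add_zero]
    rw [hx']
    exact congrArg (fun T : H →L[ℂ] H => T x) e3

lemma trans_open (B : Set (H →L[ℂ] H)) (hB : IsCStarSubalg B)
    (hsep : TopologicalSpace.IsSeparable B)
    (v p p' : H →L[ℂ] H) (hp : IsProjectionOp p) (h1 : star v * v = p)
    (hv : ∀ a ∈ her B p, v * a ∈ B) (hp' : IsOpenProjection B p') (hpp : p * p' = p') :
    IsOpenProjection B (v * p' * star v) ∧ v * p' ∈ sotClosure B := by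
  obtain ⟨k, hkB, hk0, hk1, hkk, -⟩ := ker_of_open B hB hsep _ hp'
  obtain ⟨h0, hadd, hsm, hmul, hst, hcl⟩ := id hB
  have hksa : IsSelfAdjoint k := IsSelfAdjoint.of_nonneg hk0
  have hpp' : p' * p = p' := by
    have := congrArg star hpp
    rwa [star_mul, hp.1.star_eq, hp'.1.1.star_eq] at this
  have hher : ∀ z ∈ B, IsSelfAdjoint z → (∀ x, k x = 0 → z x = 0) → z ∈ her B p := by
    intro z hz hzs hzk
    obtain ⟨e1, e2⟩ := ker_mul p' z hp'.1 hzs fun x hx => hzk x ((hkk x).2 hx)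
    refine ⟨hz, ?_⟩
    calc p * z * p = p * (p' * (z * p')) * p := by rw [e1, e2]
      _ = (p * p') * z * (p' * p) := by noncomm_ring
      _ = z := by rw [hpp, hpp', e2, e1]
  constructor
  · have hvk : v * k ∈ B := hv k (hher k hkB hksa fun x hx => hx)
    refine open_of_ker B hB _ (v * k * star (v * k)) (trans_proj v p p' h1 hp'.1 hpp)
      (hmul _ hvk _ (hst _ hvk)) (IsSelfAdjoint.mul_star_self _) fun x => ⟨fun hx => ?_, fun hx => ?_⟩
    · have e1 := conj_kill 1 (star (v * k)) zero_le_one x (by rw [star_star, mul_one]; exact hx)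
      rw [star_mul, hksa.star_eq] at e1
      have e2 : k (star v x) = 0 := e1
      have e3 := (hkk _).1 e2
      change v (p' (star v x)) = 0
      rw [e3, map_zero]
    · have e1 : p' (star v x) = 0 := by
        have : p' * star v = star v * (v * p' * star v) := by
          calc p' * star v = ((star v * v) * p') * star v := by rw [h1, hpp]
            _ = _ := by noncomm_ring
        calc p' (star v x) = (p' * star v) x := rfl
          _ = star v ((v * p' * star v) x) := by rw [this]; rfl
          _ = 0 := by rw [hx, map_zero]
      have e2 := (hkk _).2 e1
      rw [star_mul, hksa.star_eq]
      change v (k (k (star v x))) = 0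
      rw [e2, map_zero, map_zero]
  · intro ε hε F
    have hlim : ∀ x, Tendsto (fun n => ‖(v * p') x - (v * (1 - rr k n)) x‖) atTop (𝓝 0) := by
      intro x
      have h2 := (v.continuous.tendsto _).comp (rr_sot p' k hp'.1 hksa hk1 hkk x)
      have h3 := (h2.sub_const (v (x - p' x))).norm
      rw [sub_self, norm_zero] at h3
      refine h3.congr fun n => ?_
      congr 1
      simp
      abel
    have hev : ∀ᶠ n in atTop, ∀ x ∈ F, ‖(v * p') x - (v * (1 - rr k n)) x‖ < ε :=
      (Finset.eventually_all F).2 fun x _ => (hlim x).eventually (gt_mem_nhds hε)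
    obtain ⟨n, hn⟩ := hev.exists
    refine ⟨_, hv _ (hher (1 - rr k n) (rr_mem B hB k hkB n).1 ?_ ?_), hn⟩
    · rw [isSelfAdjoint_iff, star_sub, star_one, rr_sa k hksa]
    · intro x hx
      simp [rr_fix k n x hx]

lemma meet_closed (B : Set (H →L[ℂ] H)) (hB : IsCStarSubalg B)
    (hsep : TopologicalSpace.IsSeparable B) (d f : H →L[ℂ] H) (hd : IsClosedProjection B d)
    (hf : IsClosedProjection B f) :
    ∃ m, IsClosedProjection B m ∧ d * m = m ∧ f * m = m ∧
      ∀ q, d * q = q → f * q = q → m * q = q := by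
  obtain ⟨k, hkB, hk0, -, hkk, -⟩ := ker_of_open B hB hsep _ hd.2
  obtain ⟨l, hlB, hl0, -, hlk, -⟩ := ker_of_open B hB hsep _ hf.2
  have hk' : ∀ x, k x = 0 ↔ d x = x := by
    intro x
    rw [hkk, sub_apply, ContinuousLinearMap.one_apply, sub_eq_zero, eq_comm]
  have hl' : ∀ x, l x = 0 ↔ f x = x := by
    intro x
    rw [hlk, sub_apply, ContinuousLinearMap.one_apply, sub_eq_zero, eq_comm]
  have hker : ∀ x, (k + l) x = 0 ↔ d x = x ∧ f x = x := by
    intro x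
    rw [← hk', ← hl']
    constructor
    · intro hx
      exact ⟨le_kill k (k + l) hk0 (le_add_of_nonneg_right hl0) x hx,
        le_kill l (k + l) hl0 (le_add_of_nonneg_left hk0) x hx⟩
    · rintro ⟨h1, h2⟩
      simp [h1, h2]
  let K : Submodule ℂ H := ((k + l : H →L[ℂ] H) : H →ₗ[ℂ] H).ker
  have hKcl : IsClosed (K : Set H) := (k + l).isClosed_ker
  haveI : CompleteSpace K := hKcl.completeSpace_coe
  have hm : IsProjectionOp K.starProjection :=
    ⟨isSelfAdjoint_starProjection K, K.isIdempotentElem_starProjection⟩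
  have hmK : ∀ x, K.starProjection x = x ↔ (k + l) x = 0 := by
    intro x
    rw [Submodule.starProjection_eq_self_iff]
    exact Iff.rfl
  have hmm : ∀ x, (k + l) (K.starProjection x) = 0 := fun x => K.starProjection_apply_mem x
  refine ⟨K.starProjection, ⟨hm, ?_⟩, ?_, ?_, ?_⟩
  · refine open_of_ker B hB _ (k + l) (proj_compl _ hm) (hB.2.1 _ hkB _ hlB)
      (IsSelfAdjoint.of_nonneg (add_nonneg hk0 hl0)) fun x => ?_
    rw [← hmK, sub_apply, ContinuousLinearMap.one_apply, sub_eq_zero, eq_comm]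
  · ext x
    exact ((hker _).1 (hmm x)).1
  · ext x
    exact ((hker _).1 (hmm x)).2
  · intro q h1 h2
    ext x
    refine (hmK _).2 ((hker _).2 ⟨?_, ?_⟩)
    · exact congrArg (fun T : H →L[ℂ] H => T x) h1
    · exact congrArg (fun T : H →L[ℂ] H => T x) h2

lemma her_mul (B : Set (H →L[ℂ] H)) (p a : H →L[ℂ] H) (hp : IsProjectionOp p)
    (ha : a ∈ her B p) : a * p = a ∧ p * a = a := by
  have := ha.2
  constructor
  · calc a * p = (p * a * p) * p := by rw [this]
      _ = p * a * (p * p) := by noncomm_ring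
      _ = a := by rw [hp.2.eq, this]
  · calc p * a = p * (p * a * p) := by rw [this]
      _ = (p * p) * a * p := by noncomm_ring
      _ = a := by rw [hp.2.eq, this]

lemma cuLE_of (B : Set (H →L[ℂ] H)) (hB : IsCStarSubalg B)
    (hsep : TopologicalSpace.IsSeparable B) (hnd : Nondegenerate B)
    (v p Q : H →L[ℂ] H) (hp : IsProjectionOp p) (hQ : IsProjectionOp Q)
    (h1 : star v * v = p) (h2 : v * star v = Q)
    (hv : ∀ a ∈ her B p, v * a ∈ B) (hv' : ∀ a ∈ her B Q, star v * a ∈ B) : CuLE B p Q := by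
  rintro p' hp' ⟨c, ⟨hc, hpc', hmin⟩, a, ha, hapos, ha1, hca⟩
  obtain ⟨h0, hadd, hsm, hmul, hst, hcl⟩ := id hB
  have hsa : IsSelfAdjoint a := hapos.isSelfAdjoint
  obtain ⟨hap, hpa⟩ := her_mul B p a hp ha
  have hvp : v * p = v := vp v p hp h1
  have hpv : p * star v = star v := by
    have := congrArg star hvp
    rwa [star_mul, hp.1.star_eq] at this
  have hcp : c * p = c := by
    rw [← hca, mul_assoc, hap]
  have hpc : p * c = c := by
    have := congrArg star hcp
    rwa [star_mul, hp.1.star_eq, hc.1.1.star_eq] at this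
  obtain ⟨hp'c, hcp'⟩ := proj_of_le p' c hp'.1 hc.1 hpc'
  have hpp' : p * p' = p' := by rw [← hcp', ← mul_assoc, hpc]
  have hp'p : p' * p = p' := by rw [← hp'c, mul_assoc, hcp]
  obtain ⟨hq'o, hsot⟩ := trans_open B hB hsep v p p' hp h1 hv hp' hpp'
  set q' := v * p' * star v with hq'
  set d := v * c * star v with hd
  set b := v * (a * a) * star v with hb
  have ha2 : a * a ∈ her B p := by
    refine ⟨hmul _ ha.1 _ ha.1, ?_⟩
    rw [← mul_assoc, hpa, mul_assoc, hap]
  have ha2sa : IsSelfAdjoint (a * a) := by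
    rw [isSelfAdjoint_iff, star_mul, hsa.star_eq]
  have hbeq : b = v * a * star (v * a) := by
    rw [hb, star_mul, hsa.star_eq]; noncomm_ring
  have hbB : b ∈ B := by
    rw [hbeq]; exact hmul _ (hv a ha) _ (hst _ (hv a ha))
  have hca2 : c * (a * a) = c := by rw [← mul_assoc, hca, hca]
  have hQv : Q * v = v := by rw [← h2, mul_assoc, h1, hvp]
  have hvQ : star v * Q = star v := by rw [← h2, ← mul_assoc, h1, hpv]
  have hbQ : b ∈ her B Q := by
    refine ⟨hbB, ?_⟩
    calc Q * b * Q = (Q * v) * (a * a) * (star v * Q) := by rw [hb]; noncomm_ring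
      _ = b := by rw [hQv, hvQ]
  have hdb : d * b = d := by
    calc d * b = v * (c * (star v * v)) * (a * a) * star v := by rw [hd, hb]; noncomm_ring
      _ = v * (c * (a * a)) * star v := by rw [h1, hcp]; noncomm_ring
      _ = d := by rw [hca2]
  have hdcl : IsClosedProjection B d :=
    trans_closed B hB hsep hnd v p c (a * a) hp h1 hv hc ha2 ha2sa hca2 hbB
  have hbsa : IsSelfAdjoint b := by rw [hbeq]; exact IsSelfAdjoint.mul_star_self _
  have hvdv : ∀ z, p * z = z → z * p = z → star v * (v * z * star v) * v = z := by
    intro z hz1 hz2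
    calc star v * (v * z * star v) * v = (star v * v) * z * (star v * v) := by noncomm_ring
      _ = z := by rw [h1, hz1, hz2]
  have hdq' : d * q' = q' := by
    calc d * q' = v * (c * ((star v * v) * p')) * star v := by rw [hd, hq']; noncomm_ring
      _ = q' := by rw [h1, hpp', hcp']
  refine ⟨q', hq'o, ⟨d, ⟨hdcl, proj_le q' d hq'o.1 hdcl.1 hdq', fun f hf hqf => ?_⟩,
    b, hbQ, ?_, ?_, hdb⟩, v * p', hsot, ?_, ?_, ?_, ?_⟩
  · obtain ⟨m, hm, hdm, hfm, hmq⟩ := meet_closed B hB hsep d f hdcl hf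
    have hmq' := hmq q' hdq' (proj_of_le q' f hq'o.1 hf.1 hqf).2
    have hmd : m * d = m := by
      have := congrArg star hdm
      rwa [star_mul, hdcl.1.1.star_eq, hm.1.1.star_eq] at this
    have hmb : m * b = m := by rw [← hmd, mul_assoc, hdb]
    have hc'cl : IsClosedProjection B (star v * m * star (star v)) := by
      refine trans_closed B hB hsep hnd (star v) Q m b hQ (by rw [star_star, h2]) hv' hm hbQ hbsa hmb ?_
      rw [star_star, hb, hvdv _ (by rw [← mul_assoc, hpa]) (by rw [mul_assoc, hap])]
      exact ha2.1
    rw [star_star] at hc'cl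
    have hle1 : p' ≤ star v * m * v := by
      have h3 := star_left_conjugate_le_conjugate (proj_le q' m hq'o.1 hm.1 hmq') v
      rwa [hq', hvdv p' hpp' hp'p] at h3
    have hle2 : c ≤ star v * m * v := hmin _ hc'cl hle1
    have hle3 : d ≤ v * (star v * m * v) * star v := star_right_conjugate_le_conjugate hle2 v
    have hQd : Q * d = d := by rw [hd, ← mul_assoc, ← mul_assoc, hQv]
    have hdQ : d * Q = d := by rw [hd, mul_assoc, hvQ]
    have hQm : Q * m = m := by rw [← hdm, ← mul_assoc, hQd]
    have hmQ : m * Q = m := by rw [← hmd, mul_assoc, hdQ]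
    have e : v * (star v * m * v) * star v = m := by
      calc v * (star v * m * v) * star v = (v * star v) * m * (v * star v) := by noncomm_ring
        _ = m := by rw [h2, hQm, hmQ]
    rw [e] at hle3
    exact hle3.trans (proj_le m f hm.1 hf.1 hfm)
  · rw [← ContinuousLinearMap.nonneg_iff_isPositive, hbeq]
    exact mul_star_self_nonneg _
  · rw [hbeq, CStarRing.norm_self_mul_star, ← CStarRing.norm_star_mul_self]
    have e : star (v * a) * (v * a) = a * a := by
      rw [star_mul, hsa.star_eq]
      calc a * star v * (v * a) = a * ((star v * v) * a) := by noncomm_ring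
        _ = a * a := by rw [h1, hpa]
    rw [e]
    exact (norm_mul_le _ _).trans (mul_le_one₀ ha1 (norm_nonneg _) ha1)
  · rw [star_mul, hp'.1.1.star_eq]
    calc p' * star v * (v * p') = p' * ((star v * v) * p') := by noncomm_ring
      _ = p' := by rw [h1, hpp', hp'.1.2.eq]
  · rw [star_mul, hp'.1.1.star_eq]
    calc v * p' * (p' * star v) = v * (p' * p') * star v := by noncomm_ring
      _ = q' := by rw [hp'.1.2.eq]
  · intro z hz
    obtain ⟨e1, e2⟩ := her_mul B p' z hp'.1 hz
    rw [mul_assoc, e2]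
    refine hv z ⟨hz.1, ?_⟩
    calc p * z * p = p * (p' * (z * p')) * p := by rw [e1, e2]
      _ = (p * p') * z * (p' * p) := by noncomm_ring
      _ = z := by rw [hpp', hp'p, e2, e1]
  · intro z hz
    obtain ⟨e1, e2⟩ := her_mul B q' z hq'o.1 hz
    have hQq : Q * q' = q' := by rw [hq', ← mul_assoc, ← mul_assoc, hQv]
    have hqQ : q' * Q = q' := by rw [hq', mul_assoc, hvQ]
    have e3 : star (v * p') * z = star v * z := by
      rw [star_mul, hp'.1.1.star_eq]
      calc p' * star v * z = ((p * p') * star v) * z := by rw [hpp']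
        _ = star v * (q' * z) := by rw [← h1, hq']; noncomm_ring
        _ = star v * z := by rw [e2]
    rw [e3]
    refine hv' z ⟨hz.1, ?_⟩
    calc Q * z * Q = Q * (q' * (z * q')) * Q := by rw [e1, e2]
      _ = (Q * q') * z * (q' * Q) := by noncomm_ring
      _ = z := by rw [hQq, hqQ, e2, e1]

/-- partial sums -/
noncomputable def VV (s : ℕ → H →L[ℂ] H) (k : H →L[ℂ] H) (N : ℕ) : H →L[ℂ] H :=
  ∑ n ∈ Finset.range N, s n * (rr k n * k)

lemma VV_orth (s : ℕ → H →L[ℂ] H) (k : H →L[ℂ] H) (hs : ∀ m n, m ≠ n → star (s m) * s n = 0)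
    (N m : ℕ) (hm : N ≤ m) : star (s m) * VV s k N = 0 := by
  rw [VV, Finset.mul_sum]
  refine Finset.sum_eq_zero fun n hn => ?_
  rw [← mul_assoc, hs m n (by have := Finset.mem_range.1 hn; omega), zero_mul]

lemma VV_sq (s : ℕ → H →L[ℂ] H) (k : H →L[ℂ] H) (hk : IsSelfAdjoint k)
    (hs1 : ∀ n, star (s n) * s n = 1)
    (hs : ∀ m n, m ≠ n → star (s m) * s n = 0) (N : ℕ) :
    star (VV s k N) * VV s k N = 1 - rr k N := by
  induction N with
  | zero => simp [VV, rr]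
  | succ N ih =>
    have e : VV s k (N + 1) = VV s k N + s N * (rr k N * k) := Finset.sum_range_succ _ _
    have o := VV_orth s k hs N N le_rfl
    have o' : star (VV s k N) * s N = 0 := by
      have := congrArg star o
      rwa [star_mul, star_star, star_zero] at this
    have hx : star (rr k N * k) = rr k N * k := by
      rw [star_mul, hk.star_eq, rr_sa k hk, (rr_comm k N).eq]
    rw [e, rr_step, star_add, star_mul, hx]
    calc (star (VV s k N) + rr k N * k * star (s N)) * (VV s k N + s N * (rr k N * k))
        = star (VV s k N) * VV s k N + (star (VV s k N) * s N) * (rr k N * k)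
          + rr k N * k * (star (s N) * VV s k N)
          + rr k N * k * ((star (s N) * s N) * (rr k N * k)) := by noncomm_ring
      _ = _ := by rw [ih, o, o', hs1]; noncomm_ring

lemma VV_S (s : ℕ → H →L[ℂ] H) (k : H →L[ℂ] H)
    (hs1 : ∀ n, star (s n) * s n = 1)
    (hs : ∀ m n, m ≠ n → star (s m) * s n = 0) (M N : ℕ) (h : M ≤ N) :
    (∑ n ∈ Finset.range M, s n * star (s n)) * VV s k N = VV s k M := by
  rw [VV, VV, Finset.sum_mul]
  refine Finset.sum_congr rfl fun i hi => ?_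
  rw [Finset.mul_sum, Finset.sum_eq_single i]
  · calc s i * star (s i) * (s i * (rr k i * k)) = s i * ((star (s i) * s i) * (rr k i * k)) := by noncomm_ring
      _ = _ := by rw [hs1, one_mul]
  · intro j _ hj
    calc s i * star (s i) * (s j * (rr k j * k)) = s i * ((star (s i) * s j) * (rr k j * k)) := by noncomm_ring
      _ = 0 := by rw [hs i j hj.symm, zero_mul, mul_zero]
  · intro hi'
    exact absurd (Finset.mem_range.2 (lt_of_lt_of_le (Finset.mem_range.1 hi) h)) hi'

set_option maxHeartbeats 2000000 in
lemma exists_v (B : Set (H →L[ℂ] H)) (hB : IsCStarSubalg B)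
    (hsep : TopologicalSpace.IsSeparable B) (hstable : IsStableAlg B)
    (p : H →L[ℂ] H) (hp : IsOpenProjection B p) :
    ∃ v : H →L[ℂ] H, star v * v = p ∧ (∀ y ∈ B, p * y = y → v * y ∈ B) ∧
      ∀ b ∈ B, star v * b ∈ B := by
  obtain ⟨k, hkB, hk0, hk1, hkk, hk⟩ := ker_of_open B hB hsep _ hp
  obtain ⟨h0, hadd, hsm, hmul, hst, hcl⟩ := id hB
  obtain ⟨s, hsM, hs1, hs, hstr⟩ := hstable
  have hksa : IsSelfAdjoint k := IsSelfAdjoint.of_nonneg hk0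
  have hVB : ∀ N, VV s k N ∈ B := fun N =>
    Finset.sum_induction _ (· ∈ B) (fun a b ha hb => hadd a ha b hb) h0
      fun n _ => (hsM n _ (rr_mem B hB k hkB n).2).1
  have hsq := VV_sq s k hksa hs1 hs
  have hrr := rr_sot p k hp.1 hksa hk1 hkk
  have hdiff : ∀ M N, M ≤ N →
      star (VV s k N - VV s k M) * (VV s k N - VV s k M) = rr k M - rr k N := by
    intro M N hMN
    have e := VV_S s k hs1 hs M N hMN
    have e0 := VV_S s k hs1 hs M M le_rfl
    set S := ∑ n ∈ Finset.range M, s n * star (s n) with hS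
    have hSsa : star S = S := by
      rw [hS, star_sum]
      exact Finset.sum_congr rfl fun i _ => by rw [star_mul, star_star]
    have e1 : star (VV s k M) * VV s k N = 1 - rr k M := by
      rw [← hsq M]
      calc star (VV s k M) * VV s k N = star (S * VV s k M) * VV s k N := by rw [e0]
        _ = star (VV s k M) * (S * VV s k N) := by rw [star_mul, hSsa, mul_assoc]
        _ = _ := by rw [e]
    have e2 : star (VV s k N) * VV s k M = 1 - rr k M := by
      have := congrArg star e1
      rwa [star_mul, star_star, star_sub, star_one, rr_sa k hksa] at this
    rw [star_sub, sub_mul, mul_sub, mul_sub, hsq, hsq, e1, e2]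
    abel
  have hcau : ∀ x, ∃ z, Tendsto (fun N => VV s k N x) atTop (𝓝 z) := by
    intro x
    refine cauchySeq_tendsto_of_complete (Metric.cauchySeq_iff'.2 fun ε hε => ?_)
    have h2 := Metric.cauchySeq_iff'.1 (hrr x).cauchySeq (ε ^ 2 / (‖x‖ + 1)) (by positivity)
    obtain ⟨M, hM⟩ := h2
    refine ⟨M, fun N hN => ?_⟩
    have h3 := hM N hN
    rw [dist_eq_norm, lt_div_iff₀ (by positivity)] at h3
    rw [dist_eq_norm]
    have h4 : inner ℂ ((VV s k N - VV s k M) x) ((VV s k N - VV s k M) x)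
        = inner ℂ ((rr k M - rr k N) x) x := by
      rw [← hdiff M N hN]
      exact (ip_star _ _ _).symm
    have h5 : ‖(VV s k N - VV s k M) x‖ ^ 2 ≤ ‖(rr k M - rr k N) x‖ * ‖x‖ := by
      have := norm_inner_le_norm (𝕜 := ℂ) ((rr k M - rr k N) x) x
      rw [← h4, inner_self_eq_norm_sq_to_K] at this
      simpa using this
    rw [sub_apply, sub_apply, norm_sub_rev (rr k M x)] at h5
    have h6 : ‖VV s k N x - VV s k M x‖ ^ 2 < ε ^ 2 := by
      nlinarith [norm_nonneg (rr k N x - rr k M x)]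
    exact lt_of_pow_lt_pow_left₀ 2 hε.le h6
  choose g hg using hcau
  let v : H →L[ℂ] H := continuousLinearMapOfTendsto (fun N => VV s k N) (tendsto_pi_nhds.2 hg)
  have hv : ∀ x, Tendsto (fun N => VV s k N x) atTop (𝓝 (v x)) := hg
  have hvv : star v * v = p := by
    refine ContinuousLinearMap.ext fun x => ext_inner_right ℂ fun y => ?_
    have l1 : Tendsto (fun N => inner ℂ (VV s k N x) (VV s k N y)) atTop
        (𝓝 (inner ℂ (v x) (v y))) := (hv x).inner (hv y)
    have l2 : Tendsto (fun N => inner ℂ ((1 - rr k N) x) y) atTop (𝓝 (inner ℂ (p x) y)) := by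
      have := ((tendsto_const_nhds (x := x)).sub (hrr x)).inner (tendsto_const_nhds (x := y) (f := atTop)) (𝕜 := ℂ)
      rw [sub_sub_cancel] at this
      exact this
    have l3 : ∀ N, inner ℂ ((1 - rr k N) x) y = inner ℂ (VV s k N x) (VV s k N y) := by
      intro N
      rw [← hsq N]
      exact ip_star _ _ _
    simp_rw [l3] at l2
    rw [← tendsto_nhds_unique l1 l2]
    exact ip_star _ _ _
  have hSv : ∀ M, (∑ n ∈ Finset.range M, s n * star (s n)) * v = VV s k M := by
    intro M
    refine ContinuousLinearMap.ext fun x => ?_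
    have l1 := ((∑ n ∈ Finset.range M, s n * star (s n)).continuous.tendsto _).comp (hv x)
    refine tendsto_nhds_unique l1 (tendsto_const_nhds.congr' ?_)
    filter_upwards [eventually_ge_atTop M] with N hN
    exact (congrArg (fun T : H →L[ℂ] H => T x) (VV_S s k hs1 hs M N hN)).symm
  have hSsa : ∀ M, star (∑ n ∈ Finset.range M, s n * star (s n)) = ∑ n ∈ Finset.range M, s n * star (s n) := by
    intro M
    rw [star_sum]
    exact Finset.sum_congr rfl fun i _ => by rw [star_mul, star_star]
  have hVv : ∀ M, star (VV s k M) * v = 1 - rr k M := by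
    intro M
    rw [← hsq M]
    have e0 := VV_S s k hs1 hs M M le_rfl
    calc star (VV s k M) * v = star ((∑ n ∈ Finset.range M, s n * star (s n)) * VV s k M) * v := by rw [e0]
      _ = star (VV s k M) * ((∑ n ∈ Finset.range M, s n * star (s n)) * v) := by
        rw [star_mul, hSsa, mul_assoc]
      _ = _ := by rw [hSv]
  have hvV : ∀ M, star v * VV s k M = 1 - rr k M := by
    intro M
    have := congrArg star (hVv M)
    rwa [star_mul, star_star, star_sub, star_one, rr_sa k hksa] at this
  refine ⟨v, hvv, fun y hy hpy => ?_, fun b hb => ?_⟩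
  · have e : ∀ N, ‖VV s k N * y - v * y‖ ^ 2 ≤ ‖y‖ * ‖rr k N * y‖ := by
      intro N
      have e1 : star (VV s k N * y - v * y) * (VV s k N * y - v * y) = star y * (rr k N * y) := by
        calc star (VV s k N * y - v * y) * (VV s k N * y - v * y)
            = star y * ((star (VV s k N) * VV s k N - star (VV s k N) * v
              - star v * VV s k N + star v * v) * y) := by
              rw [star_sub, star_mul, star_mul]; noncomm_ring
          _ = star y * (rr k N * y) := by
              rw [hsq, hVv, hvV, hvv]
              congr 1
              calc (1 - rr k N - (1 - rr k N) - (1 - rr k N) + p) * y = rr k N * y - y + p * y := by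
                    noncomm_ring
                _ = rr k N * y := by rw [hpy]; abel
      rw [sq, ← CStarRing.norm_star_mul_self, e1]
      exact (norm_mul_le _ _).trans (by rw [norm_star])
    have l1 : Tendsto (fun N => ‖VV s k N * y - v * y‖ ^ 2) atTop (𝓝 0) := by
      refine squeeze_zero (fun N => by positivity) e ?_
      simpa using (hk y hy hpy).const_mul ‖y‖
    have l2 : Tendsto (fun N => ‖VV s k N * y - v * y‖) atTop (𝓝 0) := by
      simpa using l1.sqrt
    exact hcl.mem_of_tendsto (tendsto_iff_norm_sub_tendsto_zero.2 l2)
      (Eventually.of_forall fun N => hmul _ (hVB N) _ hy)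
  · have l : Tendsto (fun M => star (VV s k M) * b) atTop (𝓝 (star v * b)) := by
      have l1 : Tendsto (fun M => (∑ n ∈ Finset.range M, s n * star (s n)) * b) atTop (𝓝 b) := by
        rw [Metric.tendsto_atTop]
        intro ε hε
        obtain ⟨i, hi⟩ := hstr b hb ε hε
        refine ⟨i, fun j hj => ?_⟩
        have := (hi j hj).1
        rwa [one_mul, ← dist_eq_norm] at this
      have l2 := l1.const_mul (star v)
      refine l2.congr fun M => ?_
      rw [← hSv M, star_mul, hSsa, mul_assoc]
    exact hcl.mem_of_tendsto l (Eventually.of_forall fun M => hmul _ (hst _ (hVB M)) _ hb)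

/-- **Statement 13.** Let `B` be a separable stable C*-algebra (playing the role of
`A ⊗ K`, realized nondegenerately on a Hilbert space).  Every element of `Cu(A)` —
i.e. the Cuntz class of any open projection `p` of `B** = (A ⊗ K)**` — is the Cuntz
class of the strict limit of an increasing sequence of projections in
`M(A ⊗ K) = multiplierSet B`. -/
theorem every_class_is_strict_limit_of_multiplier_projections
    {H : Type*} [NormedAddCommGroup H] [InnerProductSpace ℂ H] [CompleteSpace H]
    (B : Set (H →L[ℂ] H)) (hB : IsCStarSubalg B)
    (hsep : TopologicalSpace.IsSeparable B) (hnd : Nondegenerate B)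
    (hstable : IsStableAlg B) :
    ∀ p : H →L[ℂ] H, IsOpenProjection B p →
      ∃ (P : ℕ → H →L[ℂ] H) (Q : H →L[ℂ] H),
        (∀ n, IsProjectionOp (P n) ∧ P n ∈ multiplierSet B) ∧
        (∀ n, opLE (P n) (P (n + 1))) ∧
        StrictTendsto B (fun m n : ℕ => m ≤ n) P Q ∧
        CuEquiv B Q p := by
  intro p hp
  obtain ⟨v, h1, hv, hv'⟩ := exists_v B hB hsep hstable p hp
  have hvp : v * p = v := vp v p hp.1 h1
  have hpv : p * star v = star v := by
    have := congrArg star hvp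
    rwa [star_mul, hp.1.1.star_eq] at this
  have hQ : IsProjectionOp (v * star v) := by
    refine ⟨IsSelfAdjoint.mul_star_self v, ?_⟩
    change v * star v * (v * star v) = v * star v
    calc v * star v * (v * star v) = v * (star v * v) * star v := by noncomm_ring
      _ = _ := by rw [h1, hvp]
  have hQB : ∀ b ∈ B, v * star v * b ∈ B := by
    intro b hb
    rw [mul_assoc]
    exact hv _ (hv' b hb) (by rw [← mul_assoc, hpv])
  have hst := hB.2.2.2.2.1
  have hvher : ∀ a ∈ her B p, v * a ∈ B := fun a ha => hv a ha.1 (her_mul B p a hp.1 ha).2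
  refine ⟨fun _ => v * star v, v * star v, fun _ => ⟨hQ, fun b hb => ⟨hQB b hb, ?_⟩⟩, fun _ => ?_, ?_, ?_, ?_⟩
  · have := hst _ (hQB _ (hst b hb))
    rwa [star_mul, star_star, star_mul, star_star] at this
  · change v * star v ≤ v * star v
    exact le_rfl
  · intro b _ ε hε
    exact ⟨0, fun j _ => by simpa using hε⟩
  · exact cuLE_of B hB hsep hnd (star v) (v * star v) p hQ hp.1 (by rw [star_star])
      (by rw [star_star, h1]) (fun a ha => hv' a ha.1) (by rw [star_star]; exact hvher)
  · exact cuLE_of B hB hsep hnd v p (v * star v) hp.1 hQ h1 rfl hvher fun a ha => hv' a ha.1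

end CuntzOP
end

section
/- Let A be a separable C*-algebra and let p, q be open projections in (A⊗K)** with p ≾ q (Cuntz subequivalence), and let P, Q ∈ M(A⊗K) be the corresponding projections onto the Hilbert modules E_p and E_q under Kasparov stabilization. Then for every projection P' ∈ M(A⊗K) with P' ⊂⊂ P there exists a unitary u ∈ M(A⊗K) such that uP'u* ⊂⊂ Q. -/
open Filter Topology

namespace CuntzOP

variable {H : Type*} [NormedAddCommGroup H] [InnerProductSpace ℂ H] [CompleteSpace H]

theorem aux_polar {M : Type*} [CStarAlgebra M] (z P R : M) (hz : IsUnit z)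
    (hP : star P = P) (hR : star R = R) (h : z * P = R * z) :
    ∃ u : M, star u * u = 1 ∧ u * star u = 1 ∧ u * P = R * u := by
  let := CStarAlgebra.spectralOrder M
  have := CStarAlgebra.spectralOrderedRing M
  have hu : IsUnit (star z * z) := hz.star.mul hz
  have h0 : 0 ≤ star z * z := star_mul_self_nonneg z
  have hc : Commute (star z * z) P := by
    have h2 : P * star z = star z * R := by
      have := congrArg star h
      simpa [hP, hR] using this
    show star z * z * P = P * (star z * z)
    rw [mul_assoc, h, ← mul_assoc, ← mul_assoc, h2]
  set b : M := (star z * z) ^ (-(1/2) : ℝ) with hb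
  have hbs : star b = b := (CFC.rpow_nonneg : 0 ≤ b).isSelfAdjoint
  have hbc : Commute b P := by
    rw [hb, CFC.rpow_def]
    exact Commute.cfc_nnreal hc _
  have h1 : b * (star z * z) * b = 1 := by
    have e1 : star z * z = (star z * z) ^ (1 : ℝ) := (CFC.rpow_one _ h0).symm
    calc b * (star z * z) * b = b * (star z * z) ^ (1 : ℝ) * b := by rw [← e1]
      _ = 1 := by
        rw [hb, ← CFC.rpow_add hu, ← CFC.rpow_add hu]
        norm_num
        exact CFC.rpow_zero _ h0
  have huu : star (z * b) * (z * b) = 1 := by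
    rw [star_mul, hbs, ← h1]; simp only [mul_assoc]
  have hbu : IsUnit b := by
    rw [hb, CFC.isUnit_rpow_iff _ _ (by norm_num)]; exact hu
  refine ⟨z * b, huu, ?_, ?_⟩
  · obtain ⟨w, hw⟩ := hz.mul hbu
    rw [← hw] at huu ⊢
    have : star (w : M) = (↑w⁻¹ : M) := by
      rw [← mul_one (star (w : M)), ← Units.mul_inv w, ← mul_assoc, huu, one_mul]
    rw [this, Units.mul_inv]
  · rw [mul_assoc, hbc.eq, ← mul_assoc, h, mul_assoc]

theorem aux_norm_proj {M : Type*} [CStarAlgebra M] (P : M) (hP : star P = P) (hPP : P * P = P) :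
    ‖P‖ ≤ 1 := by
  have := CStarRing.norm_star_mul_self (x := P)
  rw [hP, hPP] at this
  nlinarith [norm_nonneg P]

theorem aux_unit {M : Type*} [CStarAlgebra M] (P R v : M)
    (hP : star P = P) (hR : star R = R) (hPP : P * P = P) (hRR : R * R = R)
    (h1 : star v * v = P) (h2 : v * star v = R) (hd : ‖P * R‖ ≤ 1 / 100) :
    ∃ u : M, star u * u = 1 ∧ u * star u = 1 ∧ u * P = R * u := by
  nontriviality M
  have nP := aux_norm_proj P hP hPP
  have nR := aux_norm_proj R hR hRR
  have nv : ‖v‖ ≤ 1 := by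
    have := CStarRing.norm_star_mul_self (x := v)
    rw [h1] at this
    nlinarith [norm_nonneg v]
  have vP : v * P = v := by
    have : star (v * P - v) * (v * P - v) = 0 := by
      simp only [star_sub, star_mul, hP]
      have a1 : star v * v * P = P := by rw [h1, hPP]
      calc (P * star v - star v) * (v * P - v)
        = P * (star v * v) * P - P * (star v * v) - (star v * v) * P + star v * v := by noncomm_ring
        _ = 0 := by rw [h1, hPP, hPP]; abel
    exact sub_eq_zero.mp (CStarRing.star_mul_self_eq_zero_iff _ |>.mp this)
  have Rv : R * v = v := by rw [← h2, mul_assoc, h1, vP]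
  obtain ⟨w, hw⟩ : ∃ w, w = star v := ⟨_, rfl⟩
  rw [← hw] at h1 h2
  have nw : ‖w‖ ≤ 1 := by rw [hw, norm_star]; exact nv
  have Pw : P * w = w := by rw [hw, ← hP, ← star_mul, vP]
  have wR : w * R = w := by rw [hw, ← hR, ← star_mul, Rv]
  obtain ⟨D, hD⟩ : ∃ D, D = P * R := ⟨_, rfl⟩
  obtain ⟨F, hF⟩ : ∃ D, D = R * P := ⟨_, rfl⟩
  rw [← hD] at hd
  have nF : ‖F‖ ≤ 1 / 100 := by
    rw [hF, ← hP, ← hR, ← star_mul, norm_star, ← hD]; exact hd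
  have e1 : v * v = v * D * v := by
    calc v * v = (v * P) * (R * v) := by rw [vP, Rv]
      _ = _ := by rw [hD]; noncomm_ring
  have e2 : w * w = w * F * w := by
    calc w * w = (w * R) * (P * w) := by rw [Pw, wR]
      _ = _ := by rw [hF]; noncomm_ring
  have e3 : v * R = v * D := by rw [hD, ← mul_assoc, vP]
  have e4 : w * P = w * F := by rw [hF, ← mul_assoc, wR]
  have e5 : P * v = D * v := by rw [hD, mul_assoc, Rv]
  have e6 : R * w = F * w := by rw [hF, mul_assoc, Pw]
  set y := v + w + 1 - P - R with hy
  set z := v + (1 - R) * (w + 1) * (1 - P) with hz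
  have hyy : y * y = 1 + (v * D * v + w * F * w - v * D - w * F - D * v - F * w + D + F) := by
    rw [hy, hD, hF] at *
    linear_combination (norm := noncomm_ring) e1 + e2 + h1 + h2 - e3 - e4 - e5 - e6 - vP - wR - Rv - Pw + hPP + hRR
  have hzy : z = y + (- (F * w) - w * F + F * w * P + F) := by
    rw [hz, hy, hF] at *
    linear_combination (norm := noncomm_ring) - e6 - e4 + e6 * P
  have ny : ‖y‖ ≤ 5 := by
    have : ‖y‖ ≤ ‖v‖ + ‖w‖ + ‖(1:M)‖ + ‖P‖ + ‖R‖ := by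
      rw [hy]
      refine (norm_sub_le _ _).trans (add_le_add_left ((norm_sub_le _ _).trans (add_le_add_left norm_add₃_le _)) _)
    rw [CStarRing.norm_one] at this
    linarith
  obtain ⟨E, hE⟩ : ∃ E, E = v * D * v + w * F * w - v * D - w * F - D * v - F * w + D + F := ⟨_, rfl⟩
  obtain ⟨e, he⟩ : ∃ e, e = - (F * w) - w * F + F * w * P + F := ⟨_, rfl⟩
  have key : ∀ a b : M, ∀ s t : ℝ, ‖a‖ ≤ s → ‖b‖ ≤ t → ‖a * b‖ ≤ s * t := fun a b s t h h' =>
    (norm_mul_le a b).trans (mul_le_mul h h' (norm_nonneg _) ((norm_nonneg _).trans h))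
  have ka : ∀ a b : M, ∀ s t : ℝ, ‖a‖ ≤ s → ‖b‖ ≤ t → ‖a + b‖ ≤ s + t := fun a b s t h h' =>
    (norm_add_le a b).trans (add_le_add h h')
  have ks : ∀ a b : M, ∀ s t : ℝ, ‖a‖ ≤ s → ‖b‖ ≤ t → ‖a - b‖ ≤ s + t := fun a b s t h h' =>
    (norm_sub_le a b).trans (add_le_add h h')
  have nE : ‖E‖ ≤ 8 / 100 := by
    rw [hE]
    refine (ka _ _ _ _ (ka _ _ _ _ (ks _ _ _ _ (ks _ _ _ _ (ks _ _ _ _ (ks _ _ _ _ (ka _ _ _ _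
      (key _ _ _ _ (key _ _ _ _ nv hd) nv) (key _ _ _ _ (key _ _ _ _ nw nF) nw)) (key _ _ _ _ nv hd))
      (key _ _ _ _ nw nF)) (key _ _ _ _ hd nv)) (key _ _ _ _ nF nw)) hd) nF).trans ?_
    norm_num
  have ne : ‖e‖ ≤ 4 / 100 := by
    rw [he]
    refine (ka _ _ _ _ (ka _ _ _ _ (ks _ _ _ _ ((norm_neg _).le.trans (key _ _ _ _ nF nw))
      (key _ _ _ _ nw nF)) (key _ _ _ _ (key _ _ _ _ nF nw) nP)) nF).trans ?_
    norm_num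
  rw [← hE] at hyy
  rw [← he] at hzy
  have u1 : IsUnit (z * y) := by
    have : z * y = 1 - (- (E + e * y)) := by
      rw [hzy, add_mul, hyy]; abel
    rw [this]
    refine isUnit_one_sub_of_norm_lt_one ?_
    rw [norm_neg]
    refine (ka _ _ _ _ nE (key _ _ _ _ ne ny)).trans_lt (by norm_num)
  have u2 : IsUnit (y * z) := by
    have : y * z = 1 - (- (E + y * e)) := by
      rw [hzy, mul_add, hyy]; abel
    rw [this]
    refine isUnit_one_sub_of_norm_lt_one ?_
    rw [norm_neg]
    refine (ka _ _ _ _ nE (key _ _ _ _ ny ne)).trans_lt (by norm_num)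
  have uz : IsUnit z := by
    obtain ⟨a, ha⟩ := u1.exists_right_inv
    obtain ⟨b, hb⟩ := u2.exists_left_inv
    refine isUnit_iff_exists.mpr ⟨y * a, by rw [← mul_assoc, ha], ?_⟩
    have hr : z * (y * a) = 1 := by rw [← mul_assoc, ha]
    have hl : (b * y) * z = 1 := by rw [mul_assoc, hb]
    rw [← left_inv_eq_right_inv hl hr, hl]
  refine aux_polar z P R uz hP hR ?_
  rw [hz]
  linear_combination (norm := noncomm_ring) vP - Rv - (1 - R) * (w + 1) * hPP + hRR * (w + 1) * (1 - P)

theorem aux_mul_proj {M : Type*} [CStarAlgebra M] (v r : M) (hrs : star r = r) (hrr : r * r = r)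
    (h : star v * v = r) : v * r = v := by
  have : star (v * r - v) * (v * r - v) = 0 := by
    simp only [star_sub, star_mul, hrs]
    calc (r * star v - star v) * (v * r - v)
      = r * (star v * v) * r - r * (star v * v) - (star v * v) * r + star v * v := by noncomm_ring
      _ = 0 := by rw [h, hrr, hrr]; abel
  exact sub_eq_zero.mp (CStarRing.star_mul_self_eq_zero_iff _ |>.mp this)

theorem aux_net (A : Type*) [NonUnitalCStarAlgebra A] [Small.{0} A] :
    ∃ (ι : Type) (le : ι → ι → Prop) (φ : ι → A),
      Nonempty ι ∧ (∀ i, le i i) ∧ (∀ i j k, le i j → le j k → le i k) ∧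
      (∀ i j, ∃ k, le i k ∧ le j k) ∧
      (∀ i, ∃ y, φ i = star y * y) ∧ (∀ i j, le i j → ∃ y, φ j - φ i = star y * y) ∧
      (∀ i, ‖φ i‖ ≤ 1) ∧
      ∀ b : A, ∀ ε : ℝ, 0 < ε → ∃ i, ∀ j, le i j → ‖φ j * b - b‖ < ε := by
  let _ : PartialOrder A := CStarAlgebra.spectralOrder A
  have : StarOrderedRing A := CStarAlgebra.spectralOrderedRing A
  let T : Set A := {x : A | 0 ≤ x} ∩ Metric.ball 0 1
  let φ : Shrink.{0} T → A := fun i => ((equivShrink T).symm i : A)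
  have hφ : ∀ i, 0 ≤ φ i ∧ ‖φ i‖ < 1 := fun i => by
    have h : φ i ∈ T := ((equivShrink T).symm i).2
    exact ⟨h.1, by simpa using h.2⟩
  refine ⟨Shrink.{0} T, fun i j => φ i ≤ φ j, φ, ?_, fun i => le_rfl,
    fun i j k => le_trans, ?_, fun i => CStarAlgebra.nonneg_iff_eq_star_mul_self.mp (hφ i).1,
    fun i j h => CStarAlgebra.nonneg_iff_eq_star_mul_self.mp (sub_nonneg.mpr h),
    fun i => (hφ i).2.le, ?_⟩
  · exact ⟨equivShrink T ⟨0, by simp [T]⟩⟩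
  · intro i j
    obtain ⟨c, hc, h1, h2⟩ := CStarAlgebra.directedOn_nonneg_ball (A := A) _
      ((equivShrink T).symm i).2 _ ((equivShrink T).symm j).2
    refine ⟨equivShrink T ⟨c, hc⟩, ?_, ?_⟩
    · simpa [φ] using h1
    · simpa [φ] using h2
  · intro b η hη
    have ht := (CStarAlgebra.increasingApproximateUnit A).tendsto_mul_right b
    obtain ⟨c, hc, hcc⟩ := ((CStarAlgebra.hasBasis_approximateUnit A).tendsto_iff
      Metric.nhds_basis_ball).mp ht _ hη
    refine ⟨equivShrink T ⟨c, by simpa [T] using hc⟩, fun j hj => ?_⟩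
    have h1 := hcc (φ j) ⟨by simpa [φ] using hj, by simpa using (hφ j).2.le⟩
    rwa [Metric.mem_ball, dist_eq_norm] at h1


theorem proj_mul_of_opLE (p c : H →L[ℂ] H) (hp : IsProjectionOp p) (hc : IsProjectionOp c)
    (h : opLE p c) : p * c = p := by
  have hps : star p = p := hp.1
  have hcs : star c = c := hc.1
  have key : ∀ x, c x = 0 → p x = 0 := by
    intro x hx
    have h1 := h.re_inner_nonneg_left x
    have h2 : inner ℂ (p x) x = inner ℂ (p x) (p x) := by
      conv_lhs => rw [← hp.2.eq]
      rw [ContinuousLinearMap.mul_apply]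
      conv_lhs => rw [← hps]
      rw [ContinuousLinearMap.star_eq_adjoint, ContinuousLinearMap.adjoint_inner_left,
        ← ContinuousLinearMap.star_eq_adjoint, hps]
    rw [ContinuousLinearMap.sub_apply, hx, zero_sub, inner_neg_left, h2] at h1
    rw [map_neg] at h1
    have h3 : RCLike.re (inner ℂ (p x) (p x)) = ‖p x‖ ^ 2 := by
      rw [inner_self_eq_norm_sq (𝕜 := ℂ)]
    rw [h3] at h1
    have : ‖p x‖ = 0 := by nlinarith [norm_nonneg (p x)]
    exact norm_eq_zero.mp this
  ext x
  have h1 := key (x - c x) (by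
    rw [map_sub, ← ContinuousLinearMap.mul_apply, hc.2.eq, sub_self])
  rw [map_sub] at h1
  rw [ContinuousLinearMap.mul_apply]
  exact (sub_eq_zero.mp h1).symm

theorem isPositive_star_mul_self' (y : H →L[ℂ] H) : (star y * y).IsPositive := by
  rw [← ContinuousLinearMap.nonneg_iff_isPositive]
  exact star_mul_self_nonneg y

theorem exists_approx_unit (B : Set (H →L[ℂ] H)) (hB : IsCStarSubalg B)
    (hsep : TopologicalSpace.IsSeparable B) (hnd : Nondegenerate B) :
    ∃ (ι : Type) (le : ι → ι → Prop) (a : ι → H →L[ℂ] H),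
      Nonempty ι ∧ (∀ i, le i i) ∧ (∀ i j k, le i j → le j k → le i k) ∧
      (∀ i j, ∃ k, le i k ∧ le j k) ∧
      (∀ i, a i ∈ B) ∧ (∀ i, (a i).IsPositive) ∧
      (∀ i j, le i j → opLE (a i) (a j)) ∧
      ∀ x : H, ∀ ε : ℝ, 0 < ε → ∃ i, ∀ j, le i j → ‖a j x - x‖ < ε := by
  obtain ⟨h0, hadd, hsmul, hmul, hstar, hcl⟩ := hB
  let S : NonUnitalStarSubalgebra ℂ (H →L[ℂ] H) :=
    { carrier := B
      zero_mem' := h0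
      add_mem' := fun {x y} hx hy => hadd x hx y hy
      smul_mem' := fun c {x} hx => hsmul c x hx
      mul_mem' := fun {x y} hx hy => hmul x hx y hy
      star_mem' := fun {x} hx => hstar x hx }
  have : IsClosed (S : Set (H →L[ℂ] H)) := hcl
  have hsm : Small.{0} S := by
    have : TopologicalSpace.SeparableSpace S := hsep.separableSpace
    have : Nonempty S := ⟨0⟩
    obtain ⟨d, hd⟩ := TopologicalSpace.exists_dense_seq S
    refine small_of_injective (β := ℕ → ℝ) (f := fun b n => dist b (d n)) ?_
    intro b c hbc
    by_contra hne
    have hpos : 0 < dist b c := dist_pos.mpr hne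
    obtain ⟨n, hn⟩ := hd.exists_dist_lt b (half_pos hpos)
    have h1 := congrFun hbc n
    have h2 := dist_triangle_right b c (d n)
    simp only at h1
    linarith
  obtain ⟨ι, le, φ, j1, j2, j3, j4, j5, j6, j7, j8⟩ := aux_net S
  refine ⟨ι, le, fun i => (φ i : H →L[ℂ] H), j1, j2, j3, j4, fun i => (φ i).2, ?_, ?_, ?_⟩
  · intro i
    obtain ⟨y, hy⟩ := j5 i
    have : (φ i : H →L[ℂ] H) = star (y : H →L[ℂ] H) * y := congrArg Subtype.val hy
    show (φ i : H →L[ℂ] H).IsPositive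
    rw [this]
    exact isPositive_star_mul_self' _
  · intro i j hij
    obtain ⟨y, hy⟩ := j6 i j hij
    have : (φ j : H →L[ℂ] H) - φ i = star (y : H →L[ℂ] H) * y := congrArg Subtype.val hy
    show ((φ j : H →L[ℂ] H) - φ i).IsPositive
    rw [this]
    exact isPositive_star_mul_self' _
  · intro x ε hε
    obtain ⟨b, hb, hbx⟩ := hnd x (ε / 3) (by positivity)
    have hη : 0 < ε / 3 / (‖x‖ + 1) := by positivity
    obtain ⟨i, hi⟩ := j8 ⟨b, hb⟩ _ hη
    refine ⟨i, fun j hj => ?_⟩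
    have h1' : ‖(φ j : H →L[ℂ] H) * b - b‖ < ε / 3 / (‖x‖ + 1) := hi j hj
    have n1 : ‖(φ j : H →L[ℂ] H)‖ ≤ 1 := j7 j
    have h2 : ‖((φ j : H →L[ℂ] H) * b - b) x‖ ≤ ε / 3 := by
      refine (ContinuousLinearMap.le_opNorm _ _).trans ?_
      calc _ ≤ ε / 3 / (‖x‖ + 1) * (‖x‖ + 1) := by gcongr; linarith
        _ = ε / 3 := by field_simp
    have h3 : ‖(φ j : H →L[ℂ] H) (b x - x)‖ < ε / 3 := by
      refine (ContinuousLinearMap.le_of_opNorm_le _ n1 _).trans_lt ?_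
      simpa using hbx
    have h4 : (φ j : H →L[ℂ] H) x - x
        = ((φ j : H →L[ℂ] H) * b - b) x + (b x - x) - (φ j : H →L[ℂ] H) (b x - x) := by
      simp
    show ‖(φ j : H →L[ℂ] H) x - x‖ < ε
    rw [h4]
    have := (norm_sub_le (((φ j : H →L[ℂ] H) * b - b) x + (b x - x)) ((φ j : H →L[ℂ] H) (b x - x)))
    have h5 := norm_add_le (((φ j : H →L[ℂ] H) * b - b) x) (b x - x)
    linarith

theorem open_of_mult (B : Set (H →L[ℂ] H)) (hB : IsCStarSubalg B)
    (hsep : TopologicalSpace.IsSeparable B) (hnd : Nondegenerate B) (r : H →L[ℂ] H)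
    (hr : IsProjectionOp r) (hm : r ∈ multiplierSet B) : IsOpenProjection B r := by
  obtain ⟨ι, le, a, i1, i2, i3, i4, i5, i6, i7, i8⟩ := exists_approx_unit B hB hsep hnd
  have hrs : star r = r := hr.1
  have hconj : ∀ T : H →L[ℂ] H, T.IsPositive → (r * T * r).IsPositive := by
    intro T hT
    rw [← ContinuousLinearMap.nonneg_iff_isPositive] at hT ⊢
    have := star_left_conjugate_nonneg hT r
    rwa [hrs] at this
  refine ⟨hr, ι, le, fun i => r * a i * r, i1, i2, i3, i4, ?_, fun i => hconj _ (i6 i), ?_, ?_⟩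
  · intro i
    exact (hm _ (hm _ (i5 i)).1).2
  · intro i j hij
    have := hconj _ (i7 i j hij)
    unfold opLE
    have e : r * a j * r - r * a i * r = r * (a j - a i) * r := by noncomm_ring
    rw [e]; exact this
  · intro x ε hε
    have hn : ‖r‖ ≤ 1 := aux_norm_proj r hrs hr.2.eq
    obtain ⟨i, hi⟩ := i8 (r x) ε hε
    refine ⟨i, fun j hj => ?_⟩
    have : (r * a j * r) x - r x = r (a j (r x) - r x) := by
      rw [map_sub]
      have : r (r x) = r x := by rw [← ContinuousLinearMap.mul_apply, hr.2.eq]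
      rw [this]; rfl
    show ‖(r * a j * r) x - r x‖ < ε
    rw [this]
    refine (ContinuousLinearMap.le_of_opNorm_le _ hn _).trans_lt ?_
    simpa using hi j hj

theorem opLE_refl' (p : H →L[ℂ] H) : opLE p p := by
  unfold opLE; rw [sub_self]; exact ContinuousLinearMap.isPositive_zero

theorem compact_of_mem (B : Set (H →L[ℂ] H)) (hB : IsCStarSubalg B)
    (hsep : TopologicalSpace.IsSeparable B) (hnd : Nondegenerate B) (r q : H →L[ℂ] H)
    (hr : IsProjectionOp r) (hm : r ∈ B) (hq : star q = q) (hrq : r * q = r) :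
    IsOpenProjection B r ∧ IsCompactlyContained B r q := by
  have hrs : star r = r := hr.1
  have hrM : r ∈ multiplierSet B := fun a ha => ⟨hB.2.2.2.1 _ hm _ ha, hB.2.2.2.1 _ ha _ hm⟩
  have hqr : q * r = r := by
    have := congrArg star hrq
    simpa [hrs, hq] using this
  have hrP : r.IsPositive := by
    have := isPositive_star_mul_self' r
    rwa [hrs, hr.2.eq] at this
  have h1 : IsProjectionOp (1 - r) := by
    refine ⟨?_, hr.2.one_sub⟩
    show star (1 - r) = 1 - r
    rw [star_sub, star_one, hrs]
  have h1M : 1 - r ∈ multiplierSet B := by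
    intro a ha
    have hs : ∀ x ∈ B, ∀ y ∈ B, x - y ∈ B := by
      intro x hx y hy
      have := hB.2.1 _ hx _ (hB.2.2.1 (-1) _ hy)
      simpa [sub_eq_add_neg] using this
    rw [sub_mul, mul_sub, one_mul, mul_one]
    exact ⟨hs _ ha _ (hrM a ha).1, hs _ ha _ (hrM a ha).2⟩
  refine ⟨open_of_mult B hB hsep hnd r hr hrM, r, ⟨⟨hr, open_of_mult B hB hsep hnd _ h1 h1M⟩,
    opLE_refl' r, fun _ _ h => h⟩, r, ⟨hm, by rw [hqr, hrq]⟩, hrP, aux_norm_proj r hrs hr.2.eq,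
    hr.2.eq⟩

theorem mul_of_compact (B : Set (H →L[ℂ] H)) (r q : H →L[ℂ] H)
    (hr : IsProjectionOp r) (hq : q * q = q) (h : IsCompactlyContained B r q) :
    r * q = r ∧ ∃ a ∈ B, r * a = r := by
  obtain ⟨c, ⟨hc, hrc, _⟩, a, ⟨haB, ha⟩, _, _, hca⟩ := h
  have h1 := proj_mul_of_opLE r c hr hc.1 hrc
  have h2 : r * a = r := by
    calc r * a = r * c * a := by rw [h1]
      _ = r := by rw [mul_assoc, hca, h1]
  refine ⟨?_, a, haB, h2⟩
  have h3 : a * q = a := by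
    conv_lhs => rw [← ha]
    rw [mul_assoc, hq, ha]
  calc r * q = r * a * q := by rw [h2]
    _ = r := by rw [mul_assoc, h3, h2]

theorem isProjectionOp_conj (y r : H →L[ℂ] H) (h : star y * y = r) (hr : IsProjectionOp r) :
    IsProjectionOp (y * star y) := by
  refine ⟨IsSelfAdjoint.mul_star_self y, ?_⟩
  have hyr : y * r = y := by
    have hrs : star r = r := hr.1
    have hrr : r * r = r := hr.2
    have : star (y * r - y) * (y * r - y) = 0 := by
      simp only [star_sub, star_mul, hrs]
      calc (r * star y - star y) * (y * r - y)
        = r * (star y * y) * r - r * (star y * y) - (star y * y) * r + star y * y := by noncomm_ring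
        _ = 0 := by rw [h, hrr, hrr]; abel
    exact sub_eq_zero.mp (CStarRing.star_mul_self_eq_zero_iff _ |>.mp this)
  show y * star y * (y * star y) = y * star y
  calc y * star y * (y * star y) = y * (star y * y) * star y := by noncomm_ring
    _ = _ := by rw [h, hyr]

/-- The multiplier algebra as a star subalgebra. -/
def multSub (B : Set (H →L[ℂ] H)) (hB : IsCStarSubalg B) : StarSubalgebra ℂ (H →L[ℂ] H) where
  carrier := multiplierSet B
  mul_mem' := fun {x y} hx hy a ha => by
    refine ⟨?_, ?_⟩
    · rw [mul_assoc]; exact (hx _ (hy a ha).1).1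
    · rw [← mul_assoc]; exact (hy _ (hx a ha).2).2
  add_mem' := fun {x y} hx hy a ha => by
    rw [add_mul, mul_add]
    exact ⟨hB.2.1 _ (hx a ha).1 _ (hy a ha).1, hB.2.1 _ (hx a ha).2 _ (hy a ha).2⟩
  algebraMap_mem' := fun c a ha => by
    rw [Algebra.algebraMap_eq_smul_one, smul_mul_assoc, mul_smul_comm, one_mul, mul_one]
    exact ⟨hB.2.2.1 _ _ ha, hB.2.2.1 _ _ ha⟩
  star_mem' := fun {x} hx a ha => by
    have h1 := hx _ (hB.2.2.2.2.1 a ha)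
    have h2 := hB.2.2.2.2.1 _ h1.1
    have h3 := hB.2.2.2.2.1 _ h1.2
    rw [star_mul, star_star] at h2 h3
    exact ⟨h3, h2⟩

theorem multSub_closed (B : Set (H →L[ℂ] H)) (hB : IsCStarSubalg B) :
    IsClosed (multSub B hB : Set (H →L[ℂ] H)) := by
  have : (multSub B hB : Set (H →L[ℂ] H))
      = ⋂ a ∈ B, ((fun x => x * a) ⁻¹' B ∩ (fun x => a * x) ⁻¹' B) := by
    ext x
    simp only [Set.mem_iInter, Set.mem_inter_iff, Set.mem_preimage]
    rfl
  rw [this]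
  have hc := hB.2.2.2.2.2
  refine isClosed_biInter fun a _ => ?_
  exact (hc.preimage (continuous_id.mul continuous_const)).inter
    (hc.preimage (continuous_const.mul continuous_id))

theorem mult_unit (B : Set (H →L[ℂ] H)) (hB : IsCStarSubalg B) (P R v : H →L[ℂ] H)
    (hP : IsProjectionOp P) (hR : IsProjectionOp R) (hPm : P ∈ multiplierSet B)
    (hRm : R ∈ multiplierSet B) (hvm : v ∈ multiplierSet B)
    (h1 : star v * v = P) (h2 : v * star v = R) (hd : ‖P * R‖ ≤ 1 / 100) :
    ∃ u ∈ multiplierSet B, star u * u = 1 ∧ u * star u = 1 ∧ u * P = R * u := by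
  have := multSub_closed B hB
  obtain ⟨u, a1, a2, a3⟩ := aux_unit (M := multSub B hB) ⟨P, hPm⟩ ⟨R, hRm⟩ ⟨v, hvm⟩
    (Subtype.ext hP.1) (Subtype.ext hR.1) (Subtype.ext hP.2) (Subtype.ext hR.2)
    (Subtype.ext h1) (Subtype.ext h2) hd
  exact ⟨u, u.2, congrArg Subtype.val a1, congrArg Subtype.val a2, congrArg Subtype.val a3⟩

theorem stable_move (B : Set (H →L[ℂ] H)) (hB : IsCStarSubalg B) (hs : IsStableAlg B)
    (P R x : H →L[ℂ] H) (hP : IsProjectionOp P) (hR : IsProjectionOp R) (hPm : P ∈ B)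
    (hRm : R ∈ B) (hxm : x ∈ B) (h1 : star x * x = P) (h2 : x * star x = R) :
    ∃ u ∈ multiplierSet B, star u * u = 1 ∧ u * star u = 1 ∧ u * P * star u = R := by
  obtain ⟨s, sm, s1, -, st⟩ := hs
  have hBM : ∀ y ∈ B, y ∈ multiplierSet B := fun r hm a ha =>
    ⟨hB.2.2.2.1 _ hm _ ha, hB.2.2.2.1 _ ha _ hm⟩
  have small : ∀ b ∈ B, ∃ N, ∀ n ≥ N, ‖b * (s n * star (s n))‖ ≤ 1 / 100 ∧
      ‖(s n * star (s n)) * b‖ ≤ 1 / 100 := by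
    intro b hb
    obtain ⟨N, hN⟩ := st b hb (1 / 200) (by norm_num)
    refine ⟨N, fun n hn => ?_⟩
    have a1 := hN n hn
    have a2 := hN (n + 1) (le_trans hn (Nat.le_succ n))
    simp only [Finset.sum_range_succ] at a2
    set e := ∑ n ∈ Finset.range n, s n * star (s n)
    constructor
    · have : b * (s n * star (s n)) = (b * (e + s n * star (s n)) - b * 1) - (b * e - b * 1) := by
        noncomm_ring
      rw [this]
      refine (norm_sub_le _ _).trans ?_
      linarith [a1.2, a2.2]
    · have : (s n * star (s n)) * b = ((e + s n * star (s n)) * b - 1 * b) - (e * b - 1 * b) := by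
        noncomm_ring
      rw [this]
      refine (norm_sub_le _ _).trans ?_
      linarith [a1.1, a2.1]
  obtain ⟨N1, hN1⟩ := small P hPm
  obtain ⟨N2, hN2⟩ := small R hRm
  set n := max N1 N2
  have b1 := (hN1 n (le_max_left _ _)).1
  have b2 := (hN2 n (le_max_right _ _)).2
  set t := s n
  have tt : star t * t = 1 := s1 n
  have hPs : star P = P := hP.1
  have hPP : P * P = P := hP.2
  have hv1 : star (t * P) * (t * P) = P := by
    rw [star_mul, hPs, mul_assoc, ← mul_assoc (star t), tt, one_mul, hPP]
  have hv2 : (t * P) * star (t * P) = t * P * star t := by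
    rw [star_mul, hPs, mul_assoc, ← mul_assoc P P, hPP, ← mul_assoc]
  have hSp : IsProjectionOp (t * P * star t) := by
    rw [← hv2]; exact isProjectionOp_conj _ P hv1 hP
  set S := t * P * star t with hS
  have tS : t * star t * S = S := by
    rw [hS]
    calc t * star t * (t * P * star t) = t * (star t * t) * P * star t := by noncomm_ring
      _ = _ := by rw [tt, mul_one]
  have St : S * (t * star t) = S := by
    rw [hS]
    calc (t * P * star t) * (t * star t) = t * P * (star t * t) * star t := by noncomm_ring
      _ = _ := by rw [tt, mul_one]
  have nS : ‖S‖ ≤ 1 := aux_norm_proj S hSp.1 hSp.2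
  have tPB : t * P ∈ B := (sm n P hPm).1
  have SB : S ∈ B := by
    rw [← hv2]; exact hB.2.2.2.1 _ tPB _ (hB.2.2.2.2.1 _ tPB)
  obtain ⟨u, um, u1, u2, u3⟩ := mult_unit B hB P S (t * P) hP hSp (hBM _ hPm) (hBM _ SB)
    (hBM _ tPB) hv1 hv2 (by
      rw [← tS, ← mul_assoc]
      refine (norm_mul_le _ _).trans ?_
      nlinarith [norm_nonneg S, norm_nonneg (P * (t * star t))])
  have xP : x * P = x := by
    have : star (x * P - x) * (x * P - x) = 0 := by
      simp only [star_sub, star_mul, hPs]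
      calc (P * star x - star x) * (x * P - x)
        = P * (star x * x) * P - P * (star x * x) - (star x * x) * P + star x * x := by noncomm_ring
        _ = 0 := by rw [h1, hPP, hPP]; abel
    exact sub_eq_zero.mp (CStarRing.star_mul_self_eq_zero_iff _ |>.mp this)
  have hxt : x * star t ∈ B := by
    have : x * star t = x * star (t * P) := by
      rw [star_mul, hPs, ← mul_assoc, xP]
    rw [this]; exact hB.2.2.2.1 _ hxm _ (hB.2.2.2.2.1 _ tPB)
  have hw1 : star (x * star t) * (x * star t) = S := by
    rw [star_mul, star_star, hS, ← h1]; noncomm_ring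
  have hw2 : (x * star t) * star (x * star t) = R := by
    rw [star_mul, star_star, ← h2]
    calc x * star t * (t * star x) = x * (star t * t) * star x := by noncomm_ring
      _ = _ := by rw [tt, mul_one]
  obtain ⟨w, wm, w1, w2, w3⟩ := mult_unit B hB S R (x * star t) hSp hR (hBM _ SB) (hBM _ hRm)
    (hBM _ hxt) hw1 hw2 (by
      rw [← St, mul_assoc]
      refine (norm_mul_le _ _).trans ?_
      nlinarith [norm_nonneg S, norm_nonneg (t * star t * R)])
  refine ⟨w * u, (multSub B hB).mul_mem wm um, ?_, ?_, ?_⟩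
  · rw [star_mul]
    calc star u * star w * (w * u) = star u * (star w * w) * u := by noncomm_ring
      _ = 1 := by rw [w1, mul_one, u1]
  · rw [star_mul]
    calc w * u * (star u * star w) = w * (u * star u) * star w := by noncomm_ring
      _ = 1 := by rw [u2, mul_one, w2]
  · rw [star_mul]
    calc w * u * P * (star u * star w) = w * (u * P) * star u * star w := by noncomm_ring
      _ = (w * S) * (u * star u) * star w := by rw [u3]; noncomm_ring
      _ = R := by rw [w3, u2, mul_one, mul_assoc, w2, mul_one]


/-- **Statement 14.** Let `B` be a separable stable C*-algebra (playing the role of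
`A ⊗ K`, realized nondegenerately on a Hilbert space), let `p ≾ q` be open projections
in `B**`, and let `P, Q ∈ M(A ⊗ K) = multiplierSet B` be the corresponding Kasparov
projections onto `E_p` and `E_q`, encoded by partial isometries `wP, wQ` implementing
the PZ-equivalences `p ~PZ P`, `q ~PZ Q`.  Then for every projection
`P' ∈ M(A ⊗ K)` with `P' ⊂⊂ P` there is a unitary `u ∈ M(A ⊗ K)` with
`u P' u* ⊂⊂ Q`. -/
theorem unitary_moves_compactly_contained_projection
    {H : Type*} [NormedAddCommGroup H] [InnerProductSpace ℂ H] [CompleteSpace H]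
    (B : Set (H →L[ℂ] H)) (hB : IsCStarSubalg B)
    (hsep : TopologicalSpace.IsSeparable B) (hnd : Nondegenerate B)
    (hstable : IsStableAlg B)
    (p q : H →L[ℂ] H) (hp : IsOpenProjection B p) (hq : IsOpenProjection B q)
    (hpq : CuLE B p q)
    (P Q wP wQ : H →L[ℂ] H)
    (hP : IsProjectionOp P ∧ P ∈ multiplierSet B)
    (hQ : IsProjectionOp Q ∧ Q ∈ multiplierSet B)
    (hwP : wP ∈ sotClosure B ∧ star wP * wP = p ∧ wP * star wP = P ∧
      (∀ a ∈ her B p, wP * a ∈ B) ∧ ∀ a ∈ her B P, star wP * a ∈ B)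
    (hwQ : wQ ∈ sotClosure B ∧ star wQ * wQ = q ∧ wQ * star wQ = Q ∧
      (∀ a ∈ her B q, wQ * a ∈ B) ∧ ∀ a ∈ her B Q, star wQ * a ∈ B) :
    ∀ P' : H →L[ℂ] H, IsProjectionOp P' → P' ∈ multiplierSet B →
      IsCompactlyContained B P' P →
      ∃ u : H →L[ℂ] H, u ∈ multiplierSet B ∧ star u * u = 1 ∧ u * star u = 1 ∧
        IsCompactlyContained B (u * P' * star u) Q := by
  intro P' hP' hP'm hcc
  have hmul := hB.2.2.2.1
  have hst := hB.2.2.2.2.1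
  obtain ⟨-, p1, p2, p3, p4⟩ := hwP
  obtain ⟨-, q1, q2, q3, q4⟩ := hwQ
  have hP's : star P' = P' := hP'.1
  have hP'P' : P' * P' = P' := hP'.2
  have hPs : star P = P := hP.1.1
  obtain ⟨hPP, a, haB, ha⟩ := mul_of_compact B P' P hP' hP.1.2 hcc
  have hP'B : P' ∈ B := by rw [← ha]; exact (hP'm a haB).1
  have hPP' : P * P' = P' := by
    have := congrArg star hPP
    simpa [hP's, hPs] using this
  -- the projection under p
  obtain ⟨y, hy⟩ : ∃ y, y = star wP * P' := ⟨_, rfl⟩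
  have yB : y ∈ B := by rw [hy]; exact p4 P' ⟨hP'B, by rw [hPP', hPP]⟩
  have sy : star y = P' * wP := by rw [hy, star_mul, star_star, hP's]
  have y1 : star y * y = P' := by
    rw [sy, hy]
    calc P' * wP * (star wP * P') = P' * (wP * star wP) * P' := by noncomm_ring
      _ = P' := by rw [p2, hPP, hP'P']
  have hr : IsProjectionOp (y * star y) := isProjectionOp_conj y P' y1 hP'
  have rB : y * star y ∈ B := hmul _ yB _ (hst _ yB)
  have hpp : p * p = p := hp.1.2
  have hps : star p = p := hp.1.1
  have hwp : wP * p = wP := aux_mul_proj wP p hps hpp p1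
  have hrp : (y * star y) * p = y * star y := by
    rw [sy, mul_assoc, mul_assoc, hwp]
  obtain ⟨ro, rc⟩ := compact_of_mem B hB hsep hnd (y * star y) p hr rB hps hrp
  obtain ⟨q', hq'o, hq'c, v, -, v1, v2, v3, v4⟩ := hpq _ ro rc
  have hq'p := hq'o.1
  have hqq : q * q = q := hq.1.2
  have hqs : star q = q := hq.1.1
  obtain ⟨hq'q, -⟩ := mul_of_compact B q' q hq'p hqq hq'c
  have hqq' : q * q' = q' := by
    have hs : star q' = q' := hq'p.1
    have := congrArg star hq'q
    simpa [hs, hqs] using this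
  have vyB : v * (y * star y) ∈ B := v3 _ ⟨rB, by
    have hrr : (y * star y) * (y * star y) = y * star y := hr.2
    rw [hrr, hrr]⟩
  -- v itself lies in B
  have vr : v * (y * star y) = v := aux_mul_proj v _ hr.1 hr.2 v1
  rw [vr] at vyB
  have q'B : q' ∈ B := by rw [← v2]; exact hmul _ vyB _ (hst _ vyB)
  have wq'B : wQ * q' ∈ B := q3 q' ⟨q'B, by rw [hqq', hq'q]⟩
  have q'v : q' * v = v := by rw [← v2, mul_assoc, v1, vr]
  have qv : q * v = v := by rw [← q'v, ← mul_assoc, hqq']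
  obtain ⟨x, hx⟩ : ∃ x, x = wQ * v * y := ⟨_, rfl⟩
  have xB : x ∈ B := by
    have : x = (wQ * q') * v * y := by rw [hx, mul_assoc wQ q', q'v]
    rw [this]; exact hmul _ (hmul _ wq'B _ vyB) _ yB
  have x1 : star x * x = P' := by
    rw [hx, star_mul, star_mul]
    calc star y * (star v * star wQ) * (wQ * v * y)
        = star y * (star v * ((star wQ * wQ) * v)) * y := by noncomm_ring
      _ = (star y * y) * (star y * y) := by rw [q1, qv, v1]; noncomm_ring
      _ = P' := by rw [y1, hP'P']
  have hRp : IsProjectionOp (x * star x) := isProjectionOp_conj x P' x1 hP'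
  have RB : x * star x ∈ B := hmul _ xB _ (hst _ xB)
  obtain ⟨u, um, u1, u2, u3⟩ := stable_move B hB hstable P' (x * star x) x hP' hRp hP'B RB xB x1 rfl
  refine ⟨u, um, u1, u2, ?_⟩
  rw [u3]
  have hQs : star Q = Q := hQ.1.1
  refine (compact_of_mem B hB hsep hnd _ Q hRp RB hQs ?_).2
  have hwq : wQ * q = wQ := aux_mul_proj wQ q hqs hqq q1
  have hQw : Q * wQ = wQ := by rw [← q2, mul_assoc, q1, hwq]
  have hQx : Q * x = x := by rw [hx, ← mul_assoc, ← mul_assoc, hQw]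
  have hxQ : star x * Q = star x := by
    have := congrArg star hQx
    simpa [hQs] using this
  rw [mul_assoc, hxQ]

end CuntzOP
end
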